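/- arXiv:2409.00382 — 8 statements merged into one kernel-verified Lean document; each statement's English description precedes it below -/
import Mathlib

section
/- Let k > 1/4 and let V_k(r) = 1/(r^2 (1 - log r)^{2+k}) for 0 < r < e. For β ∈ ℝ, let v(·, β) ∈ C^0([0, e)) ∩ C^2((0, e)) be the unique solution of v'' + v'/r + V_k(r) e^v = 0 on (0, e) with v(0, β) = β. Then for any β < γ, the solutions v(·, β) and v(·, γ) intersect infinitely many times; that is, the set { r ∈ (0, e) : v(r, β) = v(r, γ) } is infinite. -/
open Filter Topology Set MeasureTheory

/-- The weight `V_k(r) = 1/(r^2 (1 - log r)^(2+k))`. -/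
noncomputable def Vk (k r : ℝ) : ℝ := 1 / (r ^ 2 * (1 - Real.log r) ^ (2 + k))

/-- `v` is a `C²` solution of `v'' + v'/r + V_k(r) e^v = 0` on `(0, e)`,
with first and second derivatives `v'` and `v''`. -/
def IsSolExp (k : ℝ) (v v' v'' : ℝ → ℝ) : Prop :=
  (∀ r ∈ Set.Ioo (0 : ℝ) (Real.exp 1), HasDerivAt v (v' r) r) ∧
  (∀ r ∈ Set.Ioo (0 : ℝ) (Real.exp 1), HasDerivAt v' (v'' r) r) ∧
  ContinuousOn v'' (Set.Ioo (0 : ℝ) (Real.exp 1)) ∧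
  (∀ r ∈ Set.Ioo (0 : ℝ) (Real.exp 1),
    v'' r + v' r / r + Vk k r * Real.exp (v r) = 0)

lemma barb (L L' g g' : ℝ → ℝ) (c M m : ℝ) (hc : 0 < c) (hM : 0 < M)
    (hL : ∀ t, HasDerivAt L (L' t) t) (hg : ∀ t, HasDerivAt g (g' t) t)
    (hg0 : ∀ t, 0 ≤ g t)
    (hL' : ∀ t, 0 ≤ t → L' t ≤ -c * g t)
    (hg' : ∀ t, 0 ≤ t → |g' t| ≤ M) (hm : ∀ t, 0 ≤ t → m ≤ L t) :
    Tendsto g atTop (𝓝 0) := by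
  have hanti : AntitoneOn L (Ici 0) := by
    apply antitoneOn_of_deriv_nonpos (convex_Ici 0)
    · exact fun t _ => (hL t).continuousAt.continuousWithinAt
    · exact fun t _ => (hL t).differentiableAt.differentiableWithinAt
    · intro t ht
      rw [interior_Ici] at ht
      rw [(hL t).deriv]
      have := hL' t (le_of_lt ht)
      nlinarith [hg0 t, mul_nonneg hc.le (hg0 t)]
  have hA : Antitone (fun t => L (max t 0)) := by
    intro a b hab
    exact hanti (mem_Ici.2 (le_max_right a 0)) (mem_Ici.2 (le_max_right b 0)) (max_le_max_right 0 hab)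
  have hlim := tendsto_atTop_ciInf hA ⟨m, by
    rintro _ ⟨t, rfl⟩; exact hm _ (le_max_right _ _)⟩
  set l := ⨅ t, L (max t 0)
  rw [Metric.tendsto_atTop] at hlim ⊢
  intro η hη
  set δ := η / (2 * M) with hδ
  have hδ0 : 0 < δ := by positivity
  obtain ⟨N, hN⟩ := hlim (c * δ * η / 4) (by positivity)
  refine ⟨max N 0, fun t ht => ?_⟩
  have htN : N ≤ t := le_trans (le_max_left _ _) ht
  have ht0 : 0 ≤ t := le_trans (le_max_right _ _) ht
  have h1 := hN t htN
  have h2 := hN (t + δ) (by linarith)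
  simp only [Real.dist_eq] at h1 h2
  rw [max_eq_left ht0] at h1
  rw [max_eq_left (by linarith)] at h2
  obtain ⟨ξ, hξ, hξe⟩ := exists_hasDerivAt_eq_slope L L' (by linarith : t < t + δ)
    (fun x _ => (hL x).continuousAt.continuousWithinAt) (fun x _ => hL x)
  obtain ⟨hξ1, hξ2⟩ := hξ
  rw [eq_div_iff (by linarith)] at hξe
  have hgξ : g ξ < η / 2 := by
    have := hL' ξ (by linarith)
    have h3 : L t - L (t + δ) < c * δ * η / 2 := by
      have := abs_lt.1 h1; have := abs_lt.1 h2; linarith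
    have h4 : c * δ * g ξ < c * δ * (η / 2) := by nlinarith
    exact lt_of_mul_lt_mul_left h4 (by positivity)
  obtain ⟨ζ, hζ, hζe⟩ := exists_hasDerivAt_eq_slope g g' hξ1
    (fun x _ => (hg x).continuousAt.continuousWithinAt) (fun x _ => hg x)
  rw [eq_div_iff (by linarith)] at hζe
  have hb := abs_le.1 (hg' ζ (by linarith [hζ.1]))
  have hMδ : M * δ = η / 2 := by rw [hδ]; field_simp
  rw [Real.dist_eq, sub_zero, abs_of_nonneg (hg0 t)]
  nlinarith [hb.1, mul_le_mul_of_nonneg_left (by linarith : ξ - t ≤ δ) hM.le]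

lemma conv (k : ℝ) (hk : 0 < k) (w p : ℝ → ℝ) (hw : ∀ t, HasDerivAt w (p t) t)
    (hp : ∀ t, HasDerivAt p (-p t + k - Real.exp (w t)) t) :
    Tendsto (fun t => Real.exp (w t)) atTop (𝓝 k) := by
  set E : ℝ → ℝ := fun t => p t ^ 2 / 2 + Real.exp (w t) - k * w t with hE
  have hEd : ∀ t, HasDerivAt E (-(p t) ^ 2) t := by
    intro t
    have := ((((hp t).pow 2).div_const 2).add (hw t).exp).sub ((hw t).const_mul k)
    refine this.congr_deriv ?_
    push_cast; ring
  have hEa : Antitone E := antitone_of_deriv_nonpos (fun t => (hEd t).differentiableAt)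
    (fun t => by rw [(hEd t).deriv]; nlinarith [sq_nonneg (p t)])
  have hlow : ∀ a b : ℝ, 0 < a → a * (b - Real.log a + 1) ≤ Real.exp b := by
    intro a b ha
    have := Real.add_one_le_exp (b - Real.log a)
    rw [Real.exp_sub, Real.exp_log ha, le_div_iff₀ ha] at this
    linarith
  set m := k * (1 - Real.log k) with hmdef
  have hm : ∀ t, m ≤ Real.exp (w t) - k * w t := fun t => by
    have := hlow k (w t) hk; rw [hmdef]; linarith
  have hwle : ∀ t, 0 ≤ t → w t ≤ E 0 - (k+1) * (1 - Real.log (k+1)) := fun t ht => by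
    have h1 := hlow (k+1) (w t) (by linarith)
    have h2 : E t ≤ E 0 := hEa ht
    have h3 : E t = p t ^ 2 / 2 + Real.exp (w t) - k * w t := rfl
    nlinarith [sq_nonneg (p t)]
  set A := Real.exp (E 0 - (k+1) * (1 - Real.log (k+1))) with hAdef
  have hA0 : 0 < A := Real.exp_pos _
  have hA : ∀ t, 0 ≤ t → Real.exp (w t) ≤ A := fun t ht => Real.exp_le_exp.2 (hwle t ht)
  set P := Real.sqrt (2 * (E 0 - m)) with hPdef
  have hP0 : 0 ≤ P := Real.sqrt_nonneg _
  have hP : ∀ t, 0 ≤ t → |p t| ≤ P := fun t ht => by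
    apply Real.abs_le_sqrt
    have h2 : E t ≤ E 0 := hEa ht
    have h3 : E t = p t ^ 2 / 2 + Real.exp (w t) - k * w t := rfl
    have := hm t
    linarith
  set f : ℝ → ℝ := fun t => Real.exp (w t) - k with hf
  have hfd : ∀ t, HasDerivAt f (Real.exp (w t) * p t) t := fun t => (hw t).exp.sub_const k
  set F := A + k with hFdef
  have hF : ∀ t, 0 ≤ t → |f t| ≤ F := fun t ht => by
    have := hA t ht
    have := Real.exp_pos (w t)
    rw [abs_le]; constructor <;> simp only [hf, hFdef] <;> linarith
  set ε := 1 / (1 + 2 * A) with hε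
  have hε0 : 0 < ε := by positivity
  have hεA : ε * (1 + 2 * A) = 1 := by rw [hε]; field_simp
  have hε1 : ε ≤ 1 := by nlinarith [mul_pos hε0 hA0]
  have key : Tendsto (fun t => p t ^ 2 + f t ^ 2) atTop (𝓝 0) := by
    apply barb (fun t => E t + ε * (p t * f t))
      (fun t => -(p t)^2 + ε * ((-p t + k - Real.exp (w t)) * f t + p t * (Real.exp (w t) * p t)))
      (fun t => p t ^ 2 + f t ^ 2)
      (fun t => 2 * p t * (-p t - f t) + 2 * f t * (Real.exp (w t) * p t))
      (ε / 2) (2 * P * (P + F) + 2 * F * (A * P) + 1) (m - ε * (P * F)) (by positivity)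
      (by positivity)
    · intro t
      exact (hEd t).add (((hp t).mul (hfd t)).const_mul ε)
    · intro t
      refine (((hp t).pow 2).add ((hfd t).pow 2)).congr_deriv ?_
      simp only [hf]; push_cast; ring
    · intro t; positivity
    · intro t ht
      have h1 : -p t + k - Real.exp (w t) = -p t - f t := by simp only [hf]; ring
      rw [h1]
      have h2 := mul_le_mul_of_nonneg_right (hA t ht) (mul_nonneg hε0.le (sq_nonneg (p t)))
      have h3 := mul_nonneg hε0.le (sq_nonneg (p t + f t))
      have h4 : (p t)^2 * (ε * (1 + 2 * A)) = (p t)^2 := by rw [hεA, mul_one]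
      have h5 := mul_nonneg (sub_nonneg.2 hε1) (sq_nonneg (p t))
      nlinarith
    · intro t ht
      have a1 := hP t ht
      have a2 := hF t ht
      have a3 := hA t ht
      have a4 : |Real.exp (w t)| ≤ A := by rwa [abs_of_pos (Real.exp_pos _)]
      have a5 : |-p t - f t| ≤ P + F := by
        have := abs_add_le (-p t) (-f t)
        rw [abs_neg, abs_neg] at this
        rw [sub_eq_add_neg]; linarith
      calc _ ≤ |2 * p t * (-p t - f t)| + |2 * f t * (Real.exp (w t) * p t)| := abs_add_le _ _
        _ = 2 * |p t| * |-p t - f t| + 2 * |f t| * (|Real.exp (w t)| * |p t|) := by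
          simp only [abs_mul, abs_two]
        _ ≤ 2 * P * (P + F) + 2 * F * (A * P) := by gcongr
        _ ≤ _ := by linarith
    · intro t ht
      have h3 : E t = p t ^ 2 / 2 + Real.exp (w t) - k * w t := rfl
      have := hm t
      have h6 : |p t * f t| ≤ P * F := by
        rw [abs_mul]
        exact mul_le_mul (hP t ht) (hF t ht) (abs_nonneg _) hP0
      have h7 := mul_le_mul_of_nonneg_left (abs_le.1 h6).1 hε0.le
      nlinarith [sq_nonneg (p t)]
  have hf0 : Tendsto (fun t => |f t|) atTop (𝓝 0) := by
    have h1 := (Real.continuous_sqrt.tendsto 0).comp key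
    rw [Real.sqrt_zero] at h1
    refine squeeze_zero (fun t => abs_nonneg _) (fun t => ?_) h1
    exact Real.abs_le_sqrt (by nlinarith [sq_nonneg (p t)])
  have h2 := (tendsto_zero_iff_abs_tendsto_zero f).2 hf0
  simpa [hf] using h2.add_const k

lemma sturm (K T : ℝ) (hK : 1 / 4 < K) (k : ℝ) (w p u q : ℝ → ℝ)
    (hw : ∀ t, HasDerivAt w (p t) t)
    (hp : ∀ t, HasDerivAt p (-p t + k - Real.exp (w t)) t)
    (hu : ∀ t, HasDerivAt u (q t) t)
    (hq : ∀ t, HasDerivAt q (-q t + k - Real.exp (u t)) t)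
    (hKu : ∀ t, T ≤ t → K ≤ Real.exp (u t)) (hpos : ∀ t, T ≤ t → u t < w t) : False := by
  set ω := Real.sqrt (K - 1/4) with hω
  have hω0 : 0 < ω := Real.sqrt_pos.2 (by linarith)
  have hω2 : ω ^ 2 = K - 1/4 := Real.sq_sqrt (by linarith)
  set W : ℝ → ℝ := fun t => Real.exp (t/2) * (((p t - q t) + (w t - u t)/2) *
    Real.sin (ω * (t - T)) - (w t - u t) * (ω * Real.cos (ω * (t - T)))) with hW
  have hWd : ∀ t, HasDerivAt W (Real.exp (t/2) * Real.sin (ω * (t - T)) *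
      (K * (w t - u t) - (Real.exp (w t) - Real.exp (u t)))) t := by
    intro t
    have hθ : HasDerivAt (fun t => ω * (t - T)) (ω * 1) t :=
      ((hasDerivAt_id t).sub_const T).const_mul ω
    have he : HasDerivAt (fun t : ℝ => Real.exp (t/2)) (Real.exp (t/2) * (1/2)) t :=
      ((hasDerivAt_id t).div_const 2).exp
    have hφ := (hw t).sub (hu t)
    have hψ := (hp t).sub (hq t)
    have := he.mul (((hψ.add (hφ.div_const 2)).mul hθ.sin).sub (hφ.mul (hθ.cos.const_mul ω)))
    refine this.congr_deriv ?_
    simp only [Pi.sub_apply, Pi.add_apply, Pi.mul_apply]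
    have hK2 : K = ω ^ 2 + 1/4 := by linarith
    rw [hK2]
    ring
  have hTω : T ≤ T + Real.pi / ω := by have := Real.pi_pos; have : 0 < Real.pi / ω := by positivity
                                       linarith
  have hanti : AntitoneOn W (Icc T (T + Real.pi / ω)) := by
    apply antitoneOn_of_deriv_nonpos (convex_Icc _ _)
    · exact fun t _ => (hWd t).continuousAt.continuousWithinAt
    · exact fun t _ => (hWd t).differentiableAt.differentiableWithinAt
    · intro t ht
      rw [interior_Icc] at ht
      rw [(hWd t).deriv]
      have hs : 0 ≤ Real.sin (ω * (t - T)) := by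
        apply Real.sin_nonneg_of_nonneg_of_le_pi
        · exact mul_nonneg hω0.le (by linarith [ht.1])
        · have h2 : t - T ≤ Real.pi / ω := by linarith [ht.2]
          rw [le_div_iff₀ hω0] at h2
          linarith
      apply mul_nonpos_of_nonneg_of_nonpos (by positivity)
      have h1 := Real.add_one_le_exp (w t - u t)
      rw [Real.exp_sub, le_div_iff₀ (Real.exp_pos _)] at h1
      have h2 := mul_le_mul_of_nonneg_right (hKu t ht.1.le) (sub_nonneg.2 (hpos t ht.1.le).le)
      linarith
  have h := hanti (left_mem_Icc.2 hTω) (right_mem_Icc.2 hTω) hTω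
  have e1 : ω * (T + Real.pi / ω - T) = Real.pi := by field_simp; ring
  simp only [hW, e1, Real.sin_pi, Real.cos_pi, sub_self, mul_zero, Real.sin_zero, Real.cos_zero] at h
  have p1 := mul_pos (Real.exp_pos (T/2)) (mul_pos (sub_pos.2 (hpos T le_rfl)) hω0)
  have p2 := mul_pos (Real.exp_pos ((T + Real.pi / ω)/2))
    (mul_pos (sub_pos.2 (hpos _ hTω)) hω0)
  linarith

lemma rmem (t : ℝ) : Real.exp (1 - Real.exp (-t)) ∈ Set.Ioo (0 : ℝ) (Real.exp 1) :=
  ⟨Real.exp_pos _, Real.exp_lt_exp.2 (by linarith [Real.exp_pos (-t)])⟩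

lemma transf (k : ℝ) (v v' v'' : ℝ → ℝ) (h : IsSolExp k v v' v'') :
    ∃ p : ℝ → ℝ,
      (∀ t, HasDerivAt (fun t => v (Real.exp (1 - Real.exp (-t))) + k * t) (p t) t) ∧
      (∀ t, HasDerivAt p (-p t + k -
        Real.exp (v (Real.exp (1 - Real.exp (-t))) + k * t)) t) := by
  obtain ⟨h1, h2, -, h4⟩ := h
  have hs : ∀ t : ℝ, HasDerivAt (fun t : ℝ => Real.exp (-t)) (-Real.exp (-t)) t := fun t => by
    refine ((hasDerivAt_id t).neg.exp).congr_deriv ?_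
    simp
  have hr : ∀ t : ℝ, HasDerivAt (fun t : ℝ => Real.exp (1 - Real.exp (-t)))
      (Real.exp (1 - Real.exp (-t)) * Real.exp (-t)) t := fun t => by
    refine ((hs t).const_sub 1).exp.congr_deriv ?_
    ring
  refine ⟨fun t => v' (Real.exp (1 - Real.exp (-t))) *
    (Real.exp (1 - Real.exp (-t)) * Real.exp (-t)) + k, fun t => ?_, fun t => ?_⟩
  · refine (((h1 _ (rmem t)).comp t (hr t)).add ((hasDerivAt_id t).const_mul k)).congr_deriv ?_
    simp
  · have hd := ((((h2 _ (rmem t)).comp t (hr t)).mul ((hr t).mul (hs t))).add_const k)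
    refine hd.congr_deriv ?_
    have e := h4 _ (rmem t)
    have hV : Real.exp (k * t) = Real.exp (1 - Real.exp (-t)) ^ 2 * Real.exp (-t) ^ 2 *
        Vk k (Real.exp (1 - Real.exp (-t))) := by
      have hpow : (1 - Real.log (Real.exp (1 - Real.exp (-t)))) ^ (2 + k)
          = Real.exp (-t) ^ 2 * Real.exp (-(k * t)) := by
        rw [Real.log_exp, sub_sub_cancel, ← Real.exp_mul, ← Real.exp_nat_mul, ← Real.exp_add]
        congr 1; push_cast; ring
      rw [Vk, hpow, Real.exp_neg (k * t)]
      field_simp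
    rw [Real.exp_add, hV]
    simp only [Function.comp, Pi.mul_apply]
    set r := Real.exp (1 - Real.exp (-t)) with hrdef
    have hr0 : r ≠ 0 := (Real.exp_pos _).ne'
    have e2 : v'' r = - (v' r / r) - Vk k r * Real.exp (v r) := by linarith
    rw [e2]
    field_simp
    ring

/-- Intersection property in the exponential case for `k > 1/4`: any two
distinct regular solutions intersect infinitely many times in `(0, e)`. -/
theorem stmt9 (k : ℝ) (hk : 1 / 4 < k) (β γ : ℝ) (hβγ : β < γ)
    (vβ vβ' vβ'' vγ vγ' vγ'' : ℝ → ℝ)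
    (hcβ : ContinuousOn vβ (Set.Ico 0 (Real.exp 1))) (h0β : vβ 0 = β)
    (hsβ : IsSolExp k vβ vβ' vβ'')
    (hcγ : ContinuousOn vγ (Set.Ico 0 (Real.exp 1))) (h0γ : vγ 0 = γ)
    (hsγ : IsSolExp k vγ vγ' vγ'') :
    {r : ℝ | r ∈ Set.Ioo (0 : ℝ) (Real.exp 1) ∧ vβ r = vγ r}.Infinite := by
  obtain ⟨p, hw, hp⟩ := transf k _ _ _ hsβ
  obtain ⟨q, hu, hq⟩ := transf k _ _ _ hsγ
  set w : ℝ → ℝ := fun t => vβ (Real.exp (1 - Real.exp (-t))) + k * t with hwd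
  set u : ℝ → ℝ := fun t => vγ (Real.exp (1 - Real.exp (-t))) + k * t with hud
  have cw := conv k (by linarith) w p hw hp
  have cu := conv k (by linarith) u q hu hq
  obtain ⟨K, hK1, hK2⟩ := exists_between hk
  have hev := (cw.eventually (eventually_ge_nhds hK2)).and (cu.eventually (eventually_ge_nhds hK2))
  obtain ⟨T₀, hT₀⟩ := eventually_atTop.1 hev
  have hinf : {t : ℝ | w t = u t}.Infinite := by
    apply Set.infinite_of_not_bddAbove
    rintro ⟨B, hB⟩
    set T := max T₀ (B + 1)
    have hne : ∀ t, T ≤ t → w t - u t ≠ 0 := fun t ht h0 => by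
      have h1 : t ≤ B := hB (show w t = u t by linarith)
      have : B + 1 ≤ T := le_max_right _ _
      linarith
    have hT : T₀ ≤ T := le_max_left _ _
    have hcont : ContinuousOn (fun t => w t - u t) (Ici T) := fun t _ =>
      ((hw t).sub (hu t)).continuousAt.continuousWithinAt
    have hsame : ∀ a b, T ≤ a → T ≤ b → w a - u a < 0 → 0 < w b - u b → False := by
      intro a b ha hb h1 h2
      obtain ⟨c, hc, hc0⟩ := isPreconnected_Ici.intermediate_value (show a ∈ Ici T from ha)
        (show b ∈ Ici T from hb) hcont ⟨h1.le, h2.le⟩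
      exact hne c hc hc0
    rcases lt_or_gt_of_ne (hne T le_rfl) with h | h
    · refine sturm K T hK1 k u q w p hu hq hw hp (fun t ht => (hT₀ t (hT.trans ht)).1)
        (fun t ht => ?_)
      rcases lt_or_gt_of_ne (hne t ht) with h' | h'
      · linarith
      · exact (hsame T t le_rfl ht h h').elim
    · refine sturm K T hK1 k w p u q hw hp hu hq (fun t ht => (hT₀ t (hT.trans ht)).2)
        (fun t ht => ?_)
      rcases lt_or_gt_of_ne (hne t ht) with h' | h'
      · exact (hsame t T ht le_rfl h' h).elim
      · linarith
  have hinj : Function.Injective (fun t : ℝ => Real.exp (1 - Real.exp (-t))) := by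
    intro a b hab
    have h1 := Real.exp_injective hab
    have h2 : Real.exp (-a) = Real.exp (-b) := by linarith
    have := Real.exp_injective h2
    linarith
  refine (hinf.image hinj.injOn).mono ?_
  rintro _ ⟨t, ht, rfl⟩
  refine ⟨rmem t, ?_⟩
  have ht' : w t = u t := ht
  simp only [hwd, hud] at ht'
  linarith
end

section
/- Let k > 0, p > 2k + 1, and let V_k(r) = 1/(r^2 (1 - log r)^{2+k}) for 0 < r < e. Suppose v is a C^2 function on (0, e) satisfying v''(r) + v'(r)/r + V_k(r) |v(r)|^p = 0 for all 0 < r < e and v(r) → ∞ as r → 0+. Then limsup_{r → 0+} (1 - log r)^{-k/(p-1)} v(r) > 0. -/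
open Filter Topology Set MeasureTheory

/-- `v` is a `C²` solution of `v'' + v'/r + V_k(r) |v|^p = 0` on `(0, e)`,
with first and second derivatives `v'` and `v''`. -/
noncomputable def IsSolPow (k p : ℝ) (v v' v'' : ℝ → ℝ) : Prop :=
  (∀ r ∈ Set.Ioo (0 : ℝ) (Real.exp 1), HasDerivAt v (v' r) r) ∧
  (∀ r ∈ Set.Ioo (0 : ℝ) (Real.exp 1), HasDerivAt v' (v'' r) r) ∧
  ContinuousOn v'' (Set.Ioo (0 : ℝ) (Real.exp 1)) ∧
  (∀ r ∈ Set.Ioo (0 : ℝ) (Real.exp 1),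
    v'' r + v' r / r + Vk k r * |v r| ^ p = 0)

lemma aux_mono (T : ℝ) (f f' : ℝ → ℝ) (hf : ∀ t, T ≤ t → HasDerivAt f (f' t) t)
    (h0 : ∀ t, T ≤ t → 0 ≤ f' t) : ∀ s t, T ≤ s → s ≤ t → f s ≤ f t := by
  have hm : MonotoneOn f (Ici T) := by
    apply monotoneOn_of_deriv_nonneg (convex_Ici T)
    · intro x hx
      exact (hf x hx).continuousAt.continuousWithinAt
    · intro x hx
      rw [interior_Ici] at hx
      exact (hf x (le_of_lt hx)).differentiableAt.differentiableWithinAt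
    · intro x hx
      rw [interior_Ici] at hx
      rw [(hf x (le_of_lt hx)).deriv]
      exact h0 x (le_of_lt hx)
  intro s t hs hst
  exact hm hs (hs.trans hst) hst

lemma aux_growth (A K c a b T : ℝ) (hA : 0 < A) (ha : 0 ≤ a) (hab : a < b)
    (h : ∀ t, T ≤ t → A * t ^ b + K ≤ c * t ^ a) : False := by
  have h1 : Tendsto (fun t : ℝ => A * t ^ (b - a)) atTop atTop :=
    (tendsto_rpow_atTop (by linarith)).const_mul_atTop hA
  obtain ⟨t, h2, h3, h4⟩ := ((h1.eventually_gt_atTop (c + |K|)).and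
    ((eventually_ge_atTop T).and (eventually_ge_atTop 1))).exists
  have h5 := h t h3
  have h6 : t ^ b = t ^ (b - a) * t ^ a := by
    rw [← Real.rpow_add (by linarith)]; ring_nf
  have h7 : 1 ≤ t ^ a := Real.one_le_rpow h4 ha
  rw [h6] at h5
  have h8 : -|K| ≤ K := neg_abs_le K
  nlinarith [abs_nonneg K]

lemma aux_rpow (q t : ℝ) (ht : 0 < t) :
    HasDerivAt (fun x : ℝ => x ^ q) (q * t ^ (q - 1)) t :=
  Real.hasDerivAt_rpow_const (Or.inl ht.ne')

lemma core (k p T c a μ : ℝ) (hk : 0 < k) (hp : 2 * k + 1 < p) (hT : 1 ≤ T)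
    (ha : a = k / (p - 1)) (hμ : μ = k / (2 * p))
    (hc0 : 0 < c) (hc : c ^ (p - 1) = μ * (1 - μ))
    (w w1 : ℝ → ℝ) (hw : ∀ t, T ≤ t → HasDerivAt w (w1 t) t)
    (hw1 : ∀ t, T ≤ t → HasDerivAt w1 (-(t ^ (-2 - k) * w t ^ p)) t)
    (hpos : ∀ t, T ≤ t → 0 < w t) (hle : ∀ t, T ≤ t → w t ≤ c * t ^ a)
    (hlim : Tendsto w atTop atTop) : False := by
  have ha0 : 0 ≤ a := by rw [ha]; exact div_nonneg hk.le (by linarith)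
  have ha1 : a < 1 / 2 := by rw [ha, div_lt_iff₀ (by linarith)]; linarith
  have hak : a * (p - 1) = k := by rw [ha]; field_simp [show p - 1 ≠ 0 by linarith]
  have hμ0 : 0 < μ := by rw [hμ]; apply div_pos hk; linarith
  have hμ1 : μ < 1 / 4 := by rw [hμ, div_lt_iff₀ (by linarith)]; linarith
  have hμp : μ * p = k / 2 := by rw [hμ]; field_simp [show p ≠ 0 by linarith]
  -- nonlinear term bound
  have hnl : ∀ t, T ≤ t → t ^ (2 : ℝ) * (t ^ (-2 - k) * w t ^ p) ≤ μ * (1 - μ) * w t := by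
    intro t ht
    have ht0 : 0 < t := by linarith
    have e1 : w t ^ p = w t ^ (p - 1) * w t := by
      rw [← Real.rpow_add_one (hpos t ht).ne']; ring_nf
    have e2 : w t ^ (p - 1) ≤ (c * t ^ a) ^ (p - 1) :=
      Real.rpow_le_rpow (hpos t ht).le (hle t ht) (by linarith)
    rw [Real.mul_rpow hc0.le (by positivity), ← Real.rpow_mul ht0.le, hak, hc] at e2
    have e3 : t ^ (2 : ℝ) * t ^ (-2 - k) * t ^ k = 1 := by
      rw [← Real.rpow_add ht0, ← Real.rpow_add ht0]
      ring_nf; exact Real.rpow_zero t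
    calc t ^ (2 : ℝ) * (t ^ (-2 - k) * w t ^ p)
        = (t ^ (2 : ℝ) * t ^ (-2 - k)) * (w t ^ (p - 1) * w t) := by rw [e1]; ring
      _ ≤ (t ^ (2 : ℝ) * t ^ (-2 - k)) * (μ * (1 - μ) * t ^ k * w t) := by
          have := (hpos t ht).le
          gcongr
      _ = (t ^ (2 : ℝ) * t ^ (-2 - k) * t ^ k) * (μ * (1 - μ) * w t) := by ring
      _ = _ := by rw [e3, one_mul]
  -- step 1
  have hG : ∀ t, T ≤ t → t * w1 t - μ * w t ≤ 0 := by
    have hm := aux_mono T (fun t => t ^ (μ - 1) * (t * w1 t - μ * w t))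
      (fun t => t ^ (μ - 2) * (μ * (1 - μ) * w t - t ^ (2 : ℝ) * (t ^ (-2 - k) * w t ^ p)))
      (by
        intro t ht
        have ht0 : 0 < t := by linarith
        have := (aux_rpow (μ - 1) t ht0).mul
          (((hasDerivAt_id t).mul (hw1 t ht)).sub ((hw t ht).const_mul μ))
        refine this.congr_deriv ?_
        have e1 : t ^ (μ - 1) = t ^ (μ - 2) * t := by
          rw [← Real.rpow_add_one ht0.ne']; ring_nf
        have e2 : t ^ (μ - 1 - 1) = t ^ (μ - 2) := by ring_nf
        have e3 : t ^ (2 : ℝ) = t * t := by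
          rw [Real.rpow_two]; ring
        simp only [id, Pi.mul_apply, Pi.sub_apply]
        rw [e2, e1, e3]; ring)
      (by
        intro t ht
        have ht0 : 0 < t := by linarith
        have := hnl t ht
        apply mul_nonneg (by positivity); linarith)
    intro t0 ht0
    by_contra! hcon
    have ht00 : 0 < t0 := by linarith
    set g := t0 ^ (μ - 1) * (t0 * w1 t0 - μ * w t0) with hg
    have hg0 : 0 < g := by positivity
    have hw1g : ∀ t, t0 ≤ t → g * t ^ (-μ) ≤ w1 t := by
      intro t ht
      have htp : 0 < t := by linarith
      have h1 : g ≤ t ^ (μ - 1) * (t * w1 t - μ * w t) := hm t0 t ht0 ht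
      have h2 := hpos t (ht0.trans ht)
      have h3 : t ^ (μ - 1) * t = t ^ μ := by
        rw [← Real.rpow_add_one htp.ne']; ring_nf
      have h4 : g ≤ t ^ μ * w1 t := by
        have : 0 ≤ t ^ (μ - 1) * (μ * w t) := by positivity
        rw [← h3]; linarith
      rw [Real.rpow_neg htp.le, ← div_eq_mul_inv, div_le_iff₀ (by positivity)]
      linarith
    have hm2 := aux_mono t0 (fun t => w t - g / (1 - μ) * t ^ (1 - μ))
      (fun t => w1 t - g * t ^ (-μ))
      (by
        intro t ht
        have htp : 0 < t := by linarith
        have := (hw t (ht0.trans ht)).sub ((aux_rpow (1 - μ) t htp).const_mul (g / (1 - μ)))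
        refine this.congr_deriv ?_
        have e : t ^ (1 - μ - 1) = t ^ (-μ) := by ring_nf
        rw [e]; field_simp [show 1 - μ ≠ 0 by linarith])
      (by intro t ht; linarith [hw1g t ht])
    refine aux_growth (g / (1 - μ)) (w t0 - g / (1 - μ) * t0 ^ (1 - μ)) c a (1 - μ) t0
      (div_pos hg0 (by linarith)) ha0 (by linarith) ?_
    intro t ht
    have := hm2 t0 t le_rfl ht
    have := hle t (ht0.trans ht)
    beta_reduce at *
    linarith
  -- step 2
  have hT0 : 0 < T := by linarith
  set C := T ^ (-μ) * w T with hC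
  have hCpos : 0 < C := mul_pos (by positivity) (hpos T le_rfl)
  have hwC : ∀ t, T ≤ t → w t ≤ C * t ^ μ := by
    have hm := aux_mono T (fun t => -(t ^ (-μ) * w t))
      (fun t => - (t ^ (-μ - 1) * (t * w1 t - μ * w t)))
      (by
        intro t ht
        have htp : 0 < t := by linarith
        have := ((aux_rpow (-μ) t htp).mul (hw t ht)).neg
        refine this.congr_deriv ?_
        have e1 : t ^ (-μ) = t ^ (-μ - 1) * t := by
          rw [← Real.rpow_add_one htp.ne']; ring_nf
        rw [e1]; ring)
      (by
        intro t ht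
        have htp : 0 < t := by linarith
        have := hG t ht
        have h2 : 0 < t ^ (-μ - 1) := by positivity
        nlinarith)
    intro t ht
    have htp : 0 < t := by linarith
    have h1 := hm T t le_rfl ht
    beta_reduce at h1
    have h2 : t ^ (-μ) * w t ≤ C := by linarith
    rw [Real.rpow_neg htp.le, inv_mul_le_iff₀ (by positivity)] at h2
    linarith
  -- step 3
  set D := C ^ p / (1 + k / 2) with hD
  have hDpos : 0 < D := by positivity
  have hsrc : ∀ t, T ≤ t → t ^ (-2 - k) * w t ^ p ≤ C ^ p * t ^ (-2 - k / 2) := by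
    intro t ht
    have htp : 0 < t := by linarith
    have e2 : w t ^ p ≤ (C * t ^ μ) ^ p :=
      Real.rpow_le_rpow (hpos t ht).le (hwC t ht) (by linarith)
    rw [Real.mul_rpow hCpos.le (by positivity), ← Real.rpow_mul htp.le, hμp] at e2
    have e3 : t ^ (-2 - k / 2) = t ^ (-2 - k) * t ^ (k / 2) := by
      rw [← Real.rpow_add htp]; ring_nf
    calc _ ≤ t ^ (-2 - k) * (C ^ p * t ^ (k / 2)) := by gcongr
      _ = _ := by rw [e3]; ring
  have hw1D : ∀ t, T ≤ t → w1 t ≤ D * t ^ (-1 - k / 2) := by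
    have hm := aux_mono T (fun t => w1 t - D * t ^ (-1 - k / 2))
      (fun t => C ^ p * t ^ (-2 - k / 2) - t ^ (-2 - k) * w t ^ p)
      (by
        intro t ht
        have htp : 0 < t := by linarith
        have := (hw1 t ht).sub ((aux_rpow (-1 - k / 2) t htp).const_mul D)
        refine this.congr_deriv ?_
        have e : t ^ (-1 - k / 2 - 1) = t ^ (-2 - k / 2) := by ring_nf
        have e2 : C ^ p = D * (1 + k / 2) := by rw [hD]; field_simp
        rw [e, e2]; ring)
      (by intro t ht; linarith [hsrc t ht])
    intro t0 ht0
    by_contra! hcon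
    have hm2 := aux_mono t0 (fun t => w t - (w1 t0 - D * t0 ^ (-1 - k / 2)) * t)
      (fun t => w1 t - (w1 t0 - D * t0 ^ (-1 - k / 2)))
      (by
        intro t ht
        have := (hw t (ht0.trans ht)).sub
          ((hasDerivAt_id t).const_mul (w1 t0 - D * t0 ^ (-1 - k / 2)))
        refine this.congr_deriv ?_
        ring)
      (by
        intro t ht
        have htp : 0 < t := by linarith
        have h1 := hm t0 t ht0 ht
        have h2 : 0 ≤ D * t ^ (-1 - k / 2) := by positivity
        beta_reduce at h1
        linarith)
    refine aux_growth (w1 t0 - D * t0 ^ (-1 - k / 2))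
      (w t0 - (w1 t0 - D * t0 ^ (-1 - k / 2)) * t0) C μ 1 t0
      (by linarith) hμ0.le (by linarith) ?_
    intro t ht
    have h1 := hm2 t0 t le_rfl ht
    have h2 := hwC t (ht0.trans ht)
    beta_reduce at h1
    rw [Real.rpow_one]
    linarith
  -- step 4
  have hm := aux_mono T (fun t => -(w t + D / (k / 2) * t ^ (-(k / 2))))
    (fun t => D * t ^ (-1 - k / 2) - w1 t)
    (by
      intro t ht
      have htp : 0 < t := by linarith
      have := ((hw t ht).add ((aux_rpow (-(k / 2)) t htp).const_mul (D / (k / 2)))).neg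
      refine this.congr_deriv ?_
      have e : t ^ (-(k / 2) - 1) = t ^ (-1 - k / 2) := by ring_nf
      rw [e]; field_simp; ring)
    (by intro t ht; linarith [hw1D t ht])
  obtain ⟨t, h1, h2⟩ := ((hlim.eventually_gt_atTop (w T + D / (k / 2) * T ^ (-(k / 2)))).and
    (eventually_ge_atTop T)).exists
  have h3 := hm T t le_rfl h2
  have htp : 0 < t := by linarith
  have h4 : 0 ≤ D / (k / 2) * t ^ (-(k / 2)) := by positivity
  beta_reduce at h3
  linarith

/-- If `p > 2k + 1` and `v` is a singular solution (i.e. `v(r) → ∞` as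
`r → 0+`), then `limsup_{r → 0+} (1 - log r)^{-k/(p-1)} v(r) > 0`, i.e. this
quantity is frequently bounded below by a positive constant near `0`. -/
theorem stmt12 (k p : ℝ) (hk : 0 < k) (hp : 2 * k + 1 < p) (v v' v'' : ℝ → ℝ)
    (hsol : IsSolPow k p v v' v'')
    (hsing : Tendsto v (𝓝[>] (0 : ℝ)) atTop) :
    ∃ c : ℝ, 0 < c ∧ ∃ᶠ r in 𝓝[>] (0 : ℝ),
      c ≤ (1 - Real.log r) ^ (-(k / (p - 1))) * v r := by
  obtain ⟨hv, hv', -, heq⟩ := hsol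
  set a := k / (p - 1) with ha
  set μ := k / (2 * p) with hμ
  have hμ0 : 0 < μ := by rw [hμ]; apply div_pos hk; linarith
  have hμ1 : μ < 1 / 4 := by rw [hμ, div_lt_iff₀ (by linarith)]; linarith
  have hδ : 0 < μ * (1 - μ) := mul_pos hμ0 (by linarith)
  set c := (μ * (1 - μ)) ^ (p - 1)⁻¹ with hc
  have hc0 : 0 < c := by positivity
  have hcp : c ^ (p - 1) = μ * (1 - μ) := by
    rw [hc, ← Real.rpow_mul hδ.le, inv_mul_cancel₀ (by linarith), Real.rpow_one]
  refine ⟨c, hc0, ?_⟩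
  by_contra hcon
  rw [not_frequently] at hcon
  have hφ : Tendsto (fun t : ℝ => Real.exp (1 - t)) atTop (𝓝[>] (0 : ℝ)) := by
    rw [tendsto_nhdsWithin_iff]
    refine ⟨?_, Eventually.of_forall fun t => Real.exp_pos _⟩
    apply Real.tendsto_exp_atBot.comp
    have := tendsto_neg_atTop_atBot (G := ℝ)
    exact (tendsto_atBot_add_const_left atTop (1 : ℝ) this).congr fun t => (sub_eq_add_neg 1 t).symm
  have hlim : Tendsto (fun t : ℝ => v (Real.exp (1 - t))) atTop atTop := hsing.comp hφ
  obtain ⟨T, hT⟩ := eventually_atTop.1 (((hφ.eventually hcon).and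
    (hlim.eventually_gt_atTop 0)).and (eventually_ge_atTop (1 : ℝ)))
  have hmem : ∀ t : ℝ, 1 ≤ t → Real.exp (1 - t) ∈ Ioo (0 : ℝ) (Real.exp 1) := by
    intro t ht
    exact ⟨Real.exp_pos _, Real.exp_lt_exp.2 (by linarith)⟩
  have hexp : ∀ t : ℝ, HasDerivAt (fun t : ℝ => Real.exp (1 - t)) (-Real.exp (1 - t)) t := by
    intro t
    have := ((hasDerivAt_id t).const_sub 1).exp
    simpa using this
  refine core k p (max T 1) c a μ hk hp (le_max_right _ _) ha hμ hc0 hcp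
    (fun t => v (Real.exp (1 - t))) (fun t => -(Real.exp (1 - t) * v' (Real.exp (1 - t))))
    ?_ ?_ ?_ ?_ hlim
  · intro t ht
    have h1 : 1 ≤ t := (le_max_right _ _).trans ht
    have := (hv _ (hmem t h1)).comp t (hexp t)
    refine this.congr_deriv ?_
    ring
  · intro t ht
    have h1 : 1 ≤ t := (le_max_right _ _).trans ht
    have h0 : 0 < t := by linarith
    have hp0 : 0 < v (Real.exp (1 - t)) := (hT t ((le_max_left _ _).trans ht)).1.2
    have := ((hexp t).mul ((hv' _ (hmem t h1)).comp t (hexp t))).neg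
    refine this.congr_deriv ?_
    have h2 := heq _ (hmem t h1)
    rw [Vk, Real.log_exp, abs_of_pos hp0, sub_sub_cancel] at h2
    have e1 : t ^ (-2 - k) = (t ^ (2 + k))⁻¹ := by
      rw [← Real.rpow_neg h0.le]; ring_nf
    simp only [Function.comp]
    rw [e1]
    have hr := Real.exp_pos (1 - t)
    generalize Real.exp (1 - t) = r at *
    have hs : 0 < t ^ (2 + k) := by positivity
    generalize t ^ (2 + k) = s at *
    generalize v r ^ p = y at *
    have h3 : r ^ 2 * (v'' r + v' r / r + 1 / (r ^ 2 * s) * y) = 0 := by rw [h2, mul_zero]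
    have h4 : r ^ 2 * (v'' r + v' r / r + 1 / (r ^ 2 * s) * y)
      = r ^ 2 * v'' r + r * v' r + s⁻¹ * y := by field_simp
    linarith
  · intro t ht
    exact (hT t ((le_max_left _ _).trans ht)).1.2
  · intro t ht
    have h0 : 0 < t := by linarith [(le_max_right T 1).trans ht]
    have h1 := (hT t ((le_max_left _ _).trans ht)).1.1
    rw [Real.log_exp, sub_sub_cancel, not_le, Real.rpow_neg h0.le,
      inv_mul_lt_iff₀ (by positivity)] at h1
    beta_reduce
    linarith
end

section
/- Let k > 0, p > k + 1, and set θ = k/(p-1). Assume 4θ^2 + 4(k-1)θ + 1 - 4k < 0 (equivalently, p_JL^- < p < p_JL^+ in the paper's notation). Suppose w : ℝ → ℝ is a C^2 function, not identically zero, satisfying w''(t) + (2θ - 1) w'(t) + θ(1 - θ)( |w(t) + 1|^p - (w(t) + 1) ) = 0 for all t ∈ ℝ and w(t) → 0 as t → -∞. Then w changes sign infinitely many times as t → -∞; that is, for every T ∈ ℝ there exist t_1 < t_2 < T with w(t_1) < 0 and w(t_2) > 0. -/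
open Filter Topology Set

lemma aux_unique (b : ℝ) (w w' w'' Q : ℝ → ℝ)
    (hd1 : ∀ t : ℝ, HasDerivAt w (w' t) t)
    (hd2 : ∀ t : ℝ, HasDerivAt w' (w'' t) t)
    (hQ : Continuous Q)
    (heq : ∀ t : ℝ, w'' t + b * w' t + Q t * w t = 0)
    (a : ℝ) (h0 : w a = 0) (h1 : w' a = 0) (t : ℝ) (hat : a ≤ t) : w t = 0 := by
  obtain ⟨L, hL⟩ := (isCompact_Icc (a := a) (b := t)).exists_bound_of_continuousOn hQ.continuousOn
  set C : ℝ := 1 + L + 2 * |b| with hC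
  let h : ℝ → ℝ := fun s => Real.exp (-C * s) * (w s ^ 2 + w' s ^ 2)
  have hder : ∀ s, HasDerivAt h (Real.exp (-C * s) * (-C) * (w s ^ 2 + w' s ^ 2)
      + Real.exp (-C * s) * (2 * w s * w' s + 2 * w' s * w'' s)) s := by
    intro s
    have e1 : HasDerivAt (fun s : ℝ => Real.exp (-C * s)) (Real.exp (-C * s) * (-C)) s := by
      simpa using ((hasDerivAt_id s).const_mul (-C)).exp
    have e2 := ((hd1 s).pow 2).add ((hd2 s).pow 2)
    refine HasDerivAt.congr_deriv (f := h) (e1.mul e2) ?_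
    simp
  have hanti : AntitoneOn h (Icc a t) := by
    apply antitoneOn_of_deriv_nonpos (convex_Icc a t)
    · exact fun s _ => (hder s).continuousAt.continuousWithinAt
    · exact fun s _ => (hder s).differentiableAt.differentiableWithinAt
    · intro s hs
      have hs' : s ∈ Icc a t := interior_subset hs
      rw [(hder s).deriv]
      have hq := abs_le.1 (by simpa using hL s hs')
      have hL0 : 0 ≤ L := by linarith [hq.1, hq.2]
      have e3 : w'' s = - b * w' s - Q s * w s := by linarith [heq s]
      have key : 2 * w s * w' s + 2 * w' s * w'' s ≤ C * (w s ^ 2 + w' s ^ 2) := by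
        rw [e3, hC]
        have k1 : 2 * (w s * w' s) ≤ w s ^ 2 + w' s ^ 2 := by nlinarith [sq_nonneg (w s - w' s)]
        have k2 : - (2 * Q s * (w s * w' s)) ≤ L * (w s ^ 2 + w' s ^ 2) := by
          nlinarith [mul_nonneg (by linarith : 0 ≤ L + Q s) (sq_nonneg (w s + w' s)),
            mul_nonneg (by linarith : 0 ≤ L - Q s) (sq_nonneg (w s - w' s)),
            mul_nonneg (by linarith : 0 ≤ L + Q s) (sq_nonneg (w s - w' s)),
            mul_nonneg (by linarith : 0 ≤ L - Q s) (sq_nonneg (w s + w' s))]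
        have k3 : - (2 * b * w' s ^ 2) ≤ 2 * |b| * (w s ^ 2 + w' s ^ 2) := by
          nlinarith [mul_nonneg (by linarith [neg_abs_le b] : 0 ≤ |b| + b) (sq_nonneg (w' s)),
            mul_nonneg (abs_nonneg b) (sq_nonneg (w s))]
        nlinarith
      nlinarith [mul_nonneg (Real.exp_pos (-C * s)).le (sub_nonneg.2 key)]
  have := hanti (left_mem_Icc.2 hat) (right_mem_Icc.2 hat) hat
  simp only [h, h0, h1] at this
  have hp := Real.exp_pos (-C * t)
  have : w t ^ 2 + w' t ^ 2 ≤ 0 := by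
    by_contra hcon
    push Not at hcon
    have := mul_pos hp hcon
    norm_num at *
    linarith
  have : w t ^ 2 = 0 := by nlinarith [sq_nonneg (w t), sq_nonneg (w' t)]
  simpa using this

lemma aux_nonneg (b c : ℝ) (w w' w'' Q : ℝ → ℝ)
    (hd1 : ∀ t : ℝ, HasDerivAt w (w' t) t)
    (hd2 : ∀ t : ℝ, HasDerivAt w' (w'' t) t)
    (hQ : Continuous Q) (hbc : b ^ 2 < 4 * c) (hlim : Tendsto Q atBot (𝓝 c))
    (heq : ∀ t : ℝ, w'' t + b * w' t + Q t * w t = 0)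
    (T : ℝ) (hT : ∀ t < T, 0 ≤ w t) : w = fun _ => 0 := by
  obtain ⟨m, hm1, hm2⟩ := exists_between (show b ^ 2 / 4 < c by linarith)
  obtain ⟨T1, hT1⟩ := eventually_atBot.1 (hlim.eventually (lt_mem_nhds hm2))
  set μ := Real.sqrt (m - b ^ 2 / 4) with hμ
  have hμ0 : 0 < μ := Real.sqrt_pos.2 (by linarith)
  have hμ2 : μ ^ 2 = m - b ^ 2 / 4 := Real.sq_sqrt (by linarith)
  have hpi : 0 < Real.pi / μ := div_pos Real.pi_pos hμ0
  have hz : ∀ a ≤ min T1 (T - 1) - Real.pi / μ, w a = 0 := by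
    intro a ha
    have ha1 : a + Real.pi / μ ≤ T1 := by linarith [min_le_left T1 (T-1)]
    have ha2 : a + Real.pi / μ < T := by linarith [min_le_right T1 (T-1)]
    let g : ℝ → ℝ := fun t => Real.exp (b / 2 * t) *
      ((w' t + b / 2 * w t) * Real.sin (μ * (t - a)) - μ * w t * Real.cos (μ * (t - a)))
    have hder : ∀ t, HasDerivAt g
        (Real.exp (b / 2 * t) * ((m - Q t) * w t * Real.sin (μ * (t - a)))) t := by
      intro t
      have e1 : HasDerivAt (fun s : ℝ => Real.exp (b / 2 * s)) (Real.exp (b / 2 * t) * (b / 2)) t := by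
        simpa using ((hasDerivAt_id t).const_mul (b / 2)).exp
      have e0 : HasDerivAt (fun s : ℝ => μ * (s - a)) μ t := by
        simpa using ((hasDerivAt_id t).sub_const a).const_mul μ
      have e2 := e1.mul ((((hd2 t).add ((hd1 t).const_mul (b / 2))).mul e0.sin).sub
        (((hd1 t).const_mul μ).mul e0.cos))
      refine HasDerivAt.congr_deriv (f := g) e2 ?_
      have e3 : w'' t = - b * w' t - Q t * w t := by linarith [heq t]
      have e4 : m = μ ^ 2 + b ^ 2 / 4 := by linarith
      simp only [Pi.add_apply, Pi.mul_apply, Pi.sub_apply]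
      rw [e3, e4]
      ring
    have hanti : AntitoneOn g (Icc a (a + Real.pi / μ)) := by
      apply antitoneOn_of_deriv_nonpos (convex_Icc _ _)
      · exact fun s _ => (hder s).continuousAt.continuousWithinAt
      · exact fun s _ => (hder s).differentiableAt.differentiableWithinAt
      · intro s hs
        have hs' : s ∈ Icc a (a + Real.pi / μ) := interior_subset hs
        rw [(hder s).deriv]
        have i1 := hT1 s (by linarith [hs'.2])
        have i2 := hT s (by linarith [hs'.2])
        have i3 : 0 ≤ Real.sin (μ * (s - a)) := by
          apply Real.sin_nonneg_of_nonneg_of_le_pi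
          · exact mul_nonneg hμ0.le (by linarith [hs'.1])
          · have : s - a ≤ Real.pi / μ := by linarith [hs'.2]
            rw [le_div_iff₀ hμ0] at this
            linarith
        apply mul_nonpos_of_nonneg_of_nonpos (Real.exp_pos _).le
        exact mul_nonpos_of_nonpos_of_nonneg
          (mul_nonpos_of_nonpos_of_nonneg (by linarith) i2) i3
    have hle : a ≤ a + Real.pi / μ := by linarith
    have hg := hanti (left_mem_Icc.2 hle) (right_mem_Icc.2 hle) hle
    have hang : μ * (a + Real.pi / μ - a) = Real.pi := by field_simp; ring
    simp only [g, hang, sub_self, mul_zero, Real.sin_zero, Real.cos_zero, Real.sin_pi,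
      Real.cos_pi] at hg
    have j1 : 0 ≤ Real.exp (b / 2 * (a + Real.pi / μ)) * (μ * w (a + Real.pi / μ)) :=
      mul_nonneg (Real.exp_pos _).le (mul_nonneg hμ0.le (hT _ ha2))
    have j2 : Real.exp (b / 2 * a) * μ * w a ≤ 0 := by nlinarith
    have j3 := hT a (by linarith)
    have j4 : 0 < Real.exp (b / 2 * a) * μ := mul_pos (Real.exp_pos _) hμ0
    exact le_antisymm (nonpos_of_mul_nonpos_right j2 j4) j3
  funext t
  set A := min T1 (T - 1) - Real.pi / μ
  rcases le_total t A with h | h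
  · exact hz t h
  · have hev : w =ᶠ[𝓝 (A - 1)] fun _ => 0 := by
      filter_upwards [Iio_mem_nhds (show A - 1 < A by linarith)] with s hs
      exact hz s (le_of_lt hs)
    have hw' : w' (A - 1) = 0 :=
      (hd1 (A - 1)).unique ((hasDerivAt_const (A - 1) (0:ℝ)).congr_of_eventuallyEq hev)
    exact aux_unique b w w' w'' Q hd1 hd2 hQ heq (A - 1) (hz _ (by linarith)) hw' t (by linarith)



/-- Any nontrivial `C²` solution of
`w'' + (2θ-1)w' + θ(1-θ)(|w+1|^p - (w+1)) = 0` on `ℝ` with `w(t) → 0` as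
`t → -∞` changes sign infinitely many times as `t → -∞`, provided
`4θ² + 4(k-1)θ + 1 - 4k < 0` where `θ = k/(p-1)` (i.e. `p⁻_JL < p < p⁺_JL`). -/
theorem stmt13 (k p θ : ℝ) (hk : 0 < k) (hp : k + 1 < p) (hθ : θ = k / (p - 1))
    (hosc : 4 * θ ^ 2 + 4 * (k - 1) * θ + 1 - 4 * k < 0)
    (w w' w'' : ℝ → ℝ)
    (hd1 : ∀ t : ℝ, HasDerivAt w (w' t) t)
    (hd2 : ∀ t : ℝ, HasDerivAt w' (w'' t) t)
    (hcont : Continuous w'')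
    (heq : ∀ t : ℝ,
      w'' t + (2 * θ - 1) * w' t + θ * (1 - θ) * (|w t + 1| ^ p - (w t + 1)) = 0)
    (hlim : Tendsto w atBot (𝓝 0))
    (hne : w ≠ fun _ => 0) :
    ∀ T : ℝ, ∃ t₁ t₂ : ℝ, t₁ < t₂ ∧ t₂ < T ∧ w t₁ < 0 ∧ 0 < w t₂ := by
  have hp1 : 0 < p - 1 := by linarith
  have hkθ : θ * (p - 1) = k := by rw [hθ]; field_simp
  let F : ℝ → ℝ := fun x => θ * (1 - θ) * (|x + 1| ^ p - (x + 1))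
  have hF0 : F 0 = 0 := by simp [F]
  have hFd : HasDerivAt F (k * (1 - θ)) 0 := by
    have e1 : HasDerivAt (fun x : ℝ => x + 1) 1 0 := (hasDerivAt_id (0:ℝ)).add_const 1
    have e2 : HasDerivAt (fun x : ℝ => (x + 1) ^ p) p 0 := by
      simpa using e1.rpow_const (p := p) (Or.inl (by norm_num))
    have e3 := (e2.sub e1).const_mul (θ * (1 - θ))
    have e4 : HasDerivAt F (θ * (1 - θ) * (p - 1)) 0 := by
      refine e3.congr_of_eventuallyEq ?_
      filter_upwards [Ioi_mem_nhds (show (-1:ℝ) < 0 by norm_num)] with x hx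
      have hx' : -1 < x := hx
      simp only [F, Pi.sub_apply]
      rw [abs_of_pos (by linarith)]
    convert e4 using 1
    rw [← hkθ]; ring
  have hFc : Continuous F := by
    have : Continuous (fun x : ℝ => |x + 1| ^ p) :=
      (by fun_prop : Continuous (fun x : ℝ => |x + 1|)).rpow_const (fun x => Or.inr (by linarith))
    fun_prop
  have hqc : Continuous (dslope F 0) := by
    rw [continuous_iff_continuousAt]
    intro x
    by_cases hx : x = 0
    · subst hx
      exact continuousAt_dslope_same.2 hFd.differentiableAt
    · exact (continuousAt_dslope_of_ne hx).2 hFc.continuousAt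
  have hwc : Continuous w := continuous_iff_continuousAt.2 fun t => (hd1 t).continuousAt
  have hq : ∀ x, F x = dslope F 0 x * x := by
    intro x
    have := sub_smul_dslope F 0 x
    simp only [sub_zero, hF0, smul_eq_mul] at this
    linarith
  have hQ : Continuous (fun t => dslope F 0 (w t)) := hqc.comp hwc
  have hQlim : Tendsto (fun t => dslope F 0 (w t)) atBot (𝓝 (k * (1 - θ))) := by
    have h1 := (hqc.tendsto 0).comp hlim
    rw [dslope_same, hFd.deriv] at h1
    exact h1
  have hbc : (2 * θ - 1) ^ 2 < 4 * (k * (1 - θ)) := by nlinarith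
  have heq' : ∀ t, w'' t + (2 * θ - 1) * w' t + dslope F 0 (w t) * w t = 0 := by
    intro t
    rw [← hq]
    exact heq t
  have hneg : ∀ T : ℝ, ∃ t < T, w t < 0 := by
    intro T
    by_contra! hcon
    exact hne (aux_nonneg _ _ w w' w'' _ hd1 hd2 hQ hbc hQlim heq' T hcon)
  have hpos : ∀ T : ℝ, ∃ t < T, 0 < w t := by
    intro T
    by_contra! hcon
    have h := aux_nonneg _ _ (fun t => - w t) (fun t => - w' t) (fun t => - w'' t) _
      (fun t => (hd1 t).neg) (fun t => (hd2 t).neg) hQ hbc hQlim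
      (fun t => by linarith [heq' t]) T (fun t ht => by linarith [hcon t ht])
    apply hne
    funext t
    have := congrFun h t
    simpa using this
  intro T
  obtain ⟨t₂, h2, h2'⟩ := hpos T
  obtain ⟨t₁, h1, h1'⟩ := hneg t₂
  exact ⟨t₁, t₂, h1, h2, h1', h2'⟩
end

section
/- Let k > 0, p ≥ 2k + 1, and set θ = k/(p-1). Suppose ŵ : ℝ → ℝ is a C^2 solution of ŵ''(s) + (2θ - 1) ŵ'(s) + θ(1 - θ)( |ŵ(s) + 1|^p - (ŵ(s) + 1) ) = 0 for all s ∈ ℝ satisfying the initial condition lim_{s → ∞} e^{θ s} (ŵ(s) + 1) = (θ(1-θ))^{-1/(p-1)}. Then ŵ(s) > -1 for all s ∈ ℝ, and both ŵ and ŵ' are bounded on ℝ. Moreover, if p > 2k + 1 then liminf_{s → -∞} ŵ(s) > -1. -/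
open Filter Topology Set

/-- The energy is nonpositive on any half line on which `u > 0`, together with its monotonicity. -/
lemma energy_aux (p m d a : ℝ) (hp : 1 < p) (hd : 0 ≤ d)
    (u u' u'' : ℝ → ℝ) (E : ℝ → ℝ)
    (hE : ∀ s, E s = u' s ^ 2 / 2 + m * (u s ^ (p + 1) / (p + 1) - u s ^ 2 / 2))
    (hd1 : ∀ s : ℝ, HasDerivAt u (u' s) s)
    (hd2 : ∀ s : ℝ, HasDerivAt u' (u'' s) s)
    (heq : ∀ s : ℝ, u'' s - d * u' s + m * (|u s| ^ p - u s) = 0)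
    (h0 : Tendsto u atTop (𝓝 0))
    (hpos : ∀ s, a < s → 0 < u s) :
    (∀ s, a < s → HasDerivAt E (d * u' s ^ 2) s) ∧ MonotoneOn E (Ioi a) ∧
      ∀ s, a < s → E s ≤ 0 := by
  have hder : ∀ s, a < s → HasDerivAt E (d * u' s ^ 2) s := by
    intro s hs
    have h1 := (((hd2 s).pow 2).div_const 2).add
      (((((hd1 s).rpow_const (p := p + 1) (Or.inr (by linarith))).div_const (p + 1)).sub
        (((hd1 s).pow 2).div_const 2)).const_mul m)
    have hEf : E = fun s => u' s ^ 2 / 2 + m * (u s ^ (p + 1) / (p + 1) - u s ^ 2 / 2) :=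
      funext hE
    rw [hEf]
    refine h1.congr_deriv ?_
    have h2 := heq s
    rw [abs_of_pos (hpos s hs)] at h2
    have h3 : u'' s = d * u' s - m * (u s ^ p - u s) := by linarith
    have h4 : p + 1 ≠ 0 := by linarith
    rw [h3, add_sub_cancel_right]
    field_simp
    ring
  have hmono : MonotoneOn E (Ioi a) := by
    apply monotoneOn_of_deriv_nonneg (convex_Ioi a)
    · exact fun s hs => (hder s hs).continuousAt.continuousWithinAt
    · rw [interior_Ioi]
      exact fun s hs => (hder s hs).differentiableAt.differentiableWithinAt
    · rw [interior_Ioi]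
      intro s hs
      rw [(hder s hs).deriv]
      positivity
  refine ⟨hder, hmono, ?_⟩
  have hmvt : ∀ t : ℝ, ∃ c, t < c ∧ u' c = u (t + 1) - u t := by
    intro t
    obtain ⟨c, hc, hc'⟩ := exists_hasDerivAt_eq_slope u u' (show t < t + 1 by linarith)
      (fun x _ => (hd1 x).continuousAt.continuousWithinAt) (fun x _ => hd1 x)
    refine ⟨c, hc.1, ?_⟩
    rw [hc']; simp
  choose c hc1 hc2 using hmvt
  have hct : Tendsto c atTop atTop :=
    tendsto_atTop_mono (fun t => (hc1 t).le) tendsto_id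
  have hu1 : Tendsto (fun t => u' (c t)) atTop (𝓝 0) := by
    simp only [hc2]
    have := (h0.comp (tendsto_atTop_add_const_right atTop (1:ℝ) tendsto_id)).sub h0
    simpa using this
  have hu0 : Tendsto (fun t => u (c t)) atTop (𝓝 0) := h0.comp hct
  have hup : Tendsto (fun t => u (c t) ^ (p + 1)) atTop (𝓝 0) := by
    have := hu0.rpow_const (p := p + 1) (Or.inr (by linarith))
    rwa [Real.zero_rpow (by linarith)] at this
  have hEt : Tendsto (fun t => E (c t)) atTop (𝓝 0) := by
    simp only [hE]
    have := ((hu1.pow 2).div_const 2).add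
      (((hup.div_const (p + 1)).sub ((hu0.pow 2).div_const 2)).const_mul m)
    simpa using this
  intro s hs
  refine ge_of_tendsto hEt ?_
  filter_upwards [eventually_ge_atTop s] with t ht
  have := hc1 t
  exact hmono hs (show a < c t by linarith) (by linarith)

/-- Behavior of the solution `ŵ` of the transformed equation
`ŵ'' + (2θ-1)ŵ' + θ(1-θ)(|ŵ+1|^p - (ŵ+1)) = 0` with the initial condition
`e^{θs}(ŵ(s)+1) → (θ(1-θ))^{-1/(p-1)}` as `s → ∞`, in the case `p ≥ 2k+1`:
`ŵ > -1` everywhere, `ŵ` and `ŵ'` are bounded, and if `p > 2k+1` then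
`liminf_{s → -∞} ŵ(s) > -1`. -/
theorem stmt14 (k p θ : ℝ) (hk : 0 < k) (hp : 2 * k + 1 ≤ p)
    (hθ : θ = k / (p - 1))
    (w w' w'' : ℝ → ℝ)
    (hd1 : ∀ s : ℝ, HasDerivAt w (w' s) s)
    (hd2 : ∀ s : ℝ, HasDerivAt w' (w'' s) s)
    (hcont : Continuous w'')
    (heq : ∀ s : ℝ,
      w'' s + (2 * θ - 1) * w' s + θ * (1 - θ) * (|w s + 1| ^ p - (w s + 1)) = 0)
    (hinit : Tendsto (fun s => Real.exp (θ * s) * (w s + 1)) atTop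
      (𝓝 ((θ * (1 - θ)) ^ (-(1 / (p - 1)))))) :
    (∀ s : ℝ, -1 < w s) ∧
    (∃ C : ℝ, ∀ s : ℝ, |w s| ≤ C ∧ |w' s| ≤ C) ∧
    (2 * k + 1 < p → ∃ c : ℝ, -1 < c ∧ ∀ᶠ s in atBot, c ≤ w s) := by
  have hp1 : 1 < p := by linarith
  have hθ0 : 0 < θ := by rw [hθ]; exact div_pos hk (by linarith)
  have hθ1 : θ ≤ 1 / 2 := by
    rw [hθ, div_le_div_iff₀ (by linarith) (by norm_num)]; linarith
  obtain ⟨m, hm⟩ : ∃ m, m = θ * (1 - θ) := ⟨_, rfl⟩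
  have hm0 : 0 < m := by rw [hm]; exact mul_pos hθ0 (by linarith)
  have hm1 : m ≤ 1 := by rw [hm]; nlinarith
  rw [← hm] at hinit
  have hA : 0 < m ^ (-(1 / (p - 1))) := Real.rpow_pos_of_pos hm0 _
  set u : ℝ → ℝ := fun s => w s + 1 with hu
  have hud : ∀ s, HasDerivAt u (w' s) s := fun s => (hd1 s).add_const 1
  have hueq : ∀ s : ℝ, w'' s - (1 - 2 * θ) * w' s + m * (|u s| ^ p - u s) = 0 := by
    intro s
    have := heq s
    rw [← hm] at this
    simp only [hu]
    linarith
  have hucont : Continuous u := continuous_iff_continuousAt.2 fun s => (hud s).continuousAt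
  have h0 : Tendsto u atTop (𝓝 0) := by
    have h1 : Tendsto (fun s => Real.exp (-(θ * s))) atTop (𝓝 0) :=
      Real.tendsto_exp_neg_atTop_nhds_zero.comp (tendsto_id.const_mul_atTop hθ0)
    have h2 := h1.mul hinit
    rw [zero_mul] at h2
    refine h2.congr fun s => ?_
    rw [← mul_assoc, ← Real.exp_add]
    simp [hu]
  have hev : ∀ᶠ s in atTop, 0 < u s := by
    filter_upwards [hinit.eventually (lt_mem_nhds hA)] with s hs
    exact (pos_iff_pos_of_mul_pos hs).1 (Real.exp_pos _)
  obtain ⟨E, hE⟩ : ∃ E : ℝ → ℝ, ∀ s, E s = w' s ^ 2 / 2 +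
      m * (u s ^ (p + 1) / (p + 1) - u s ^ 2 / 2) := ⟨_, fun _ => rfl⟩
  have key := fun a => energy_aux p m (1 - 2 * θ) a hp1 (by linarith) u w' w'' E hE hud hd2 hueq h0
  have hbd : ∀ s, 0 < u s → E s ≤ 0 → |w' s| ≤ u s := by
    intro s hs hes
    rw [hE] at hes
    have h1 : 0 < u s ^ (p + 1) / (p + 1) :=
      div_pos (Real.rpow_pos_of_pos hs _) (by linarith)
    have h2 : w' s ^ 2 ≤ u s ^ 2 := by nlinarith [mul_pos hm0 h1, sq_nonneg (u s)]
    exact abs_le_of_sq_le_sq h2 hs.le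
  have hpos : ∀ s, 0 < u s := by
    by_contra hcon
    push Not at hcon
    obtain ⟨N, hN⟩ := eventually_atTop.1 hev
    have hcl : IsClosed {s | u s ≤ 0} := isClosed_le hucont continuous_const
    have hbdd : BddAbove {s | u s ≤ 0} :=
      ⟨N, fun s hs => le_of_not_gt fun h => absurd (hN s h.le) (not_lt.2 hs)⟩
    have hmem : sSup {s | u s ≤ 0} ∈ {s | u s ≤ 0} := hcl.csSup_mem hcon hbdd
    set a := sSup {s | u s ≤ 0} with ha
    have hap : ∀ s, a < s → 0 < u s := by
      intro s hs
      by_contra h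
      exact absurd (le_csSup hbdd (show s ∈ {s | u s ≤ 0} from not_lt.1 h)) (not_le.2 hs)
    obtain ⟨_, _, hneg⟩ := key a hap
    have hder : ∀ s, HasDerivAt (fun s => Real.exp (-s) * u s)
        (Real.exp (-s) * (-1) * u s + Real.exp (-s) * w' s) s := fun s =>
      ((hasDerivAt_neg s).exp).mul (hud s)
    have hanti : AntitoneOn (fun s => Real.exp (-s) * u s) (Ici a) := by
      apply antitoneOn_of_deriv_nonpos (convex_Ici a)
      · exact fun s hs => (hder s).continuousAt.continuousWithinAt
      · exact fun s hs => (hder s).differentiableAt.differentiableWithinAt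
      · rw [interior_Ici]
        intro s hs
        rw [(hder s).deriv]
        have h1 := le_of_abs_le (hbd s (hap s hs) (hneg s hs))
        nlinarith [Real.exp_pos (-s)]
    have h1 := hanti (show a ∈ Ici a from le_refl a) (show a + 1 ∈ Ici a by simp) (by linarith)
    have h2 := mul_pos (Real.exp_pos (-(a + 1))) (hap (a + 1) (by linarith))
    have h3 : u a ≤ 0 := hmem
    have h4 := mul_nonpos_of_nonneg_of_nonpos (Real.exp_pos (-a)).le h3
    simp only at h1
    linarith
  have hEneg : ∀ s, E s ≤ 0 := fun s => (key (s - 1) fun t _ => hpos t).2.2 s (by linarith)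
  have hEder : ∀ s, HasDerivAt E ((1 - 2 * θ) * w' s ^ 2) s :=
    fun s => (key (s - 1) fun t _ => hpos t).1 s (by linarith)
  have hEmono : ∀ s t, s ≤ t → E s ≤ E t := fun s t hst =>
    (key (s - 1) fun t _ => hpos t).2.1 (show s - 1 < s by linarith)
      (show s - 1 < t by linarith) hst
  refine ⟨fun s => by have := hpos s; simp only [hu] at this; linarith, ?_, ?_⟩
  · have hB : ∀ s, u s ≤ ((p + 1) / 2) ^ (1 / (p - 1)) := by
      intro s
      have hs := hpos s
      have h1 := hEneg s
      rw [hE] at h1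
      have h2 : u s ^ (p + 1) / (p + 1) - u s ^ 2 / 2 ≤ 0 := by
        by_contra h
        have := mul_pos hm0 (not_le.1 h)
        nlinarith [sq_nonneg (w' s)]
      have h3 : u s ^ (p + 1) = u s ^ (p - 1) * u s ^ 2 := by
        rw [← Real.rpow_natCast, ← Real.rpow_add hs]
        congr 1
        push_cast
        ring
      have h4 : u s ^ (p - 1) ≤ (p + 1) / 2 := by
        rw [h3, sub_nonpos, div_le_div_iff₀ (by linarith) (by norm_num)] at h2
        have h5 : 0 < u s ^ 2 := by positivity
        by_contra h
        nlinarith [mul_pos h5 (sub_pos.2 (not_le.1 h))]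
      have h6 := Real.rpow_le_rpow (by positivity) h4
        (show 0 ≤ 1 / (p - 1) from div_nonneg zero_le_one (by linarith))
      rwa [← Real.rpow_mul hs.le, mul_one_div_cancel (by linarith), Real.rpow_one] at h6
    refine ⟨((p + 1) / 2) ^ (1 / (p - 1)) + 1, fun s => ⟨?_, ?_⟩⟩
    · have h1 := hB s
      have h2 := hpos s
      simp only [hu] at h1 h2
      rw [abs_le]
      constructor <;> linarith
    · linarith [hbd s (hpos s) (hEneg s), hB s]
  · intro hp2
    have hθ2 : θ < 1 / 2 := by
      rw [hθ, div_lt_div_iff₀ (by linarith) (by norm_num)]; linarith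
    have hex : ∃ s, E s < 0 := by
      by_contra hcon
      push Not at hcon
      have hEz : E = fun _ => (0:ℝ) := funext fun s => le_antisymm (hEneg s) (hcon s)
      have hw0 : ∀ s, w' s = 0 := by
        intro s
        have h1 := hEder s
        rw [hEz] at h1
        have h2 := h1.unique (hasDerivAt_const s (0:ℝ))
        have h3 := (mul_eq_zero.1 h2).resolve_left (by linarith)
        exact pow_eq_zero_iff (two_ne_zero) |>.1 h3
      have hconst : ∀ s, u s = u 0 := fun s =>
        is_const_of_deriv_eq_zero (fun x => (hud x).differentiableAt)
          (fun x => by rw [(hud x).deriv, hw0]) s 0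
      have hc : Tendsto u atTop (𝓝 (u 0)) := by
        rw [show u = fun _ => u 0 from funext hconst]
        exact tendsto_const_nhds
      have := tendsto_nhds_unique hc h0
      exact absurd this (hpos 0).ne'
    obtain ⟨a, ha⟩ := hex
    have hc0 : 0 < Real.sqrt (-E a) := Real.sqrt_pos.2 (by linarith)
    refine ⟨-1 + Real.sqrt (-E a), by linarith, ?_⟩
    filter_upwards [eventually_le_atBot a] with s hs
    have h1 := hEmono s a hs
    have h2 := hpos s
    rw [hE s] at h1
    have h3 : 0 < u s ^ (p + 1) / (p + 1) :=
      div_pos (Real.rpow_pos_of_pos h2 _) (by linarith)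
    have h4 : -E a ≤ u s ^ 2 := by
      nlinarith [mul_pos hm0 h3, sq_nonneg (u s), sq_nonneg (w' s)]
    have h5 : Real.sqrt (-E a) ≤ u s := Real.sqrt_le_iff.2 ⟨h2.le, h4⟩
    simp only [hu] at h5
    linarith
end

section
/- Let k > 0, p = 2k + 1, and set θ = k/(p-1) = 1/2. Suppose ŵ : ℝ → ℝ is a C^2 solution of ŵ''(s) + θ(1 - θ)( |ŵ(s) + 1|^p - (ŵ(s) + 1) ) = 0 for all s ∈ ℝ satisfying lim_{s → ∞} e^{θ s} (ŵ(s) + 1) = (θ(1-θ))^{-1/(p-1)}. Then there exists a real number t_1 such that ŵ'(t) < 0 for all t > t_1, ŵ'(t_1) = 0, ŵ'(t) > 0 for all t < t_1, and lim_{t → -∞} ŵ(t) = -1. -/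
open Filter Topology Set

/-- Behavior of the solution `ŵ` of the transformed equation
`ŵ'' + θ(1-θ)(|ŵ+1|^p - (ŵ+1)) = 0` with the initial condition
`e^{θs}(ŵ(s)+1) → (θ(1-θ))^{-1/(p-1)}` as `s → ∞`, in the critical case
`p = 2k + 1` (so `θ = 1/2` and the damping vanishes): there is `t₁` with
`ŵ' < 0` on `(t₁, ∞)`, `ŵ'(t₁) = 0`, `ŵ' > 0` on `(-∞, t₁)`, and
`ŵ(t) → -1` as `t → -∞`. -/
theorem stmt16 (k p θ : ℝ) (hk : 0 < k) (hp : p = 2 * k + 1)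
    (hθ : θ = 1 / 2)
    (w w' w'' : ℝ → ℝ)
    (hd1 : ∀ s : ℝ, HasDerivAt w (w' s) s)
    (hd2 : ∀ s : ℝ, HasDerivAt w' (w'' s) s)
    (hcont : Continuous w'')
    (heq : ∀ s : ℝ,
      w'' s + θ * (1 - θ) * (|w s + 1| ^ p - (w s + 1)) = 0)
    (hinit : Tendsto (fun s => Real.exp (θ * s) * (w s + 1)) atTop
      (𝓝 ((θ * (1 - θ)) ^ (-(1 / (p - 1)))))) :
    ∃ t₁ : ℝ,
      (∀ t : ℝ, t₁ < t → w' t < 0) ∧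
      w' t₁ = 0 ∧
      (∀ t : ℝ, t < t₁ → 0 < w' t) ∧
      Tendsto w atBot (𝓝 (-1)) := by
  have hp1 : 1 < p := by linarith
  subst hθ
  -- eventual positivity and decay
  have hL : (0:ℝ) < ((1 / 2 : ℝ) * (1 - 1 / 2)) ^ (-(1 / (p - 1))) :=
    Real.rpow_pos_of_pos (by norm_num) _
  have hevpos : ∀ᶠ s in atTop, 0 < w s + 1 := by
    filter_upwards [hinit.eventually (lt_mem_nhds hL)] with s hs
    exact (pos_iff_pos_of_mul_pos hs).1 (Real.exp_pos _)
  have hexp0 : Tendsto (fun s : ℝ => Real.exp (-(1 / 2 * s))) atTop (𝓝 0) := by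
    apply Real.tendsto_exp_neg_atTop_nhds_zero.comp
    exact tendsto_id.const_mul_atTop (by norm_num)
  have hu0 : Tendsto (fun s => w s + 1) atTop (𝓝 0) := by
    have h := hexp0.mul hinit
    rw [zero_mul] at h
    refine h.congr fun s => ?_
    rw [← mul_assoc, ← Real.exp_add]; simp
  have hdu : ∀ s, HasDerivAt (fun s => w s + 1) (w' s) s := fun s => (hd1 s).add_const 1
  have hw'' : ∀ s, w'' s = (w s + 1) / 4 - |w s + 1| ^ p / 4 := fun s => by
    have := heq s
    linarith
  -- energy
  have hF : ∀ s, HasDerivAt (fun s => |w s + 1| ^ p * (w s + 1))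
      ((p + 1) * |w s + 1| ^ p * w' s) s := fun s => by
    have h1 := ((hasDerivAt_abs_rpow (w s + 1) hp1).comp s (hdu s)).mul (hdu s)
    refine h1.congr_deriv ?_
    have h2 : |w s + 1| ^ (p - 2) * (w s + 1) * (w s + 1) = |w s + 1| ^ p := by
      rcases eq_or_ne (w s + 1) 0 with h | h
      · rw [h]; simp [Real.zero_rpow (by linarith : p ≠ 0)]
      · have h3 : |w s + 1| ^ p = |w s + 1| ^ (p - 2) * |w s + 1| ^ (2:ℝ) := by
          rw [← Real.rpow_add (abs_pos.2 h)]; congr 1; ring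
        rw [h3, Real.rpow_two, sq_abs]; ring
    simp only [Function.comp]
    linear_combination p * w' s * h2
  set E : ℝ → ℝ := fun s => w' s ^ 2 - (w s + 1) ^ 2 / 4
    + (|w s + 1| ^ p * (w s + 1)) / (2 * (p + 1)) with hE
  have hdE : ∀ s, HasDerivAt E 0 s := fun s => by
    have h1 := (((hd2 s).pow 2).sub (((hdu s).pow 2).div_const 4)).add
      ((hF s).div_const (2 * (p + 1)))
    refine h1.congr_deriv ?_
    rw [hw'' s]
    have : p + 1 ≠ 0 := by linarith
    field_simp
    ring
  have hEc : ∀ s, E s = E 0 := fun s =>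
    is_const_of_deriv_eq_zero (fun s => (hdE s).differentiableAt) (fun s => (hdE s).deriv) s 0
  have hsq : Tendsto (fun s => w' s ^ 2) atTop (𝓝 (E 0)) := by
    have hc : Continuous (fun x : ℝ => x ^ 2 / 4 - (|x| ^ p * x) / (2 * (p + 1))) := by
      have : Continuous (fun x : ℝ => |x| ^ p) :=
        continuous_abs.rpow_const (fun x => Or.inr (by linarith))
      fun_prop
    have h1 := ((hc.tendsto 0).comp hu0).const_add (E 0)
    simp only [ne_eq, OfNat.ofNat_ne_zero, not_false_eq_true, zero_pow, zero_div, mul_zero,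
      sub_zero, add_zero] at h1
    refine h1.congr fun s => ?_
    rw [← hEc s]
    simp only [hE, Function.comp]
    ring
  have hE0 : E 0 = 0 := by
    have hm : ∀ s : ℝ, ∃ c, s < c ∧ w' c = (w (s + 1) + 1) - (w s + 1) := fun s => by
      obtain ⟨c, hc, h⟩ := exists_hasDerivAt_eq_slope w w' (by linarith : s < s + 1)
        (fun x _ => (hd1 x).continuousAt.continuousWithinAt) (fun x _ => hd1 x)
      exact ⟨c, hc.1, by rw [h]; ring⟩
    choose c hc1 hc2 using hm
    have hcT : Tendsto c atTop atTop := tendsto_atTop_mono (fun s => (hc1 s).le) tendsto_id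
    have h1 : Tendsto (fun s => w' (c s) ^ 2) atTop (𝓝 (E 0)) := hsq.comp hcT
    have h2 : Tendsto (fun s => w' (c s) ^ 2) atTop (𝓝 0) := by
      have h3 := ((hu0.comp (tendsto_atTop_add_const_right atTop 1 tendsto_id)).sub hu0).pow 2
      simp only [sub_zero, ne_eq, OfNat.ofNat_ne_zero, not_false_eq_true, zero_pow] at h3
      refine h3.congr fun s => ?_
      rw [hc2 s]; rfl
    exact tendsto_nhds_unique h1 h2
  have hen : ∀ s, w' s ^ 2 = (w s + 1) ^ 2 / 4
      - (|w s + 1| ^ p * (w s + 1)) / (2 * (p + 1)) := fun s => by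
    have := hEc s
    rw [hE0] at this
    simp only [hE] at this
    linarith
  -- positivity
  have hucont : Continuous (fun s => w s + 1) :=
    continuous_iff_continuousAt.2 fun s => (hdu s).continuousAt
  have hpos : ∀ s, 0 < w s + 1 := by
    by_contra! hcon
    obtain ⟨a, ha⟩ := hcon
    obtain ⟨M, hM⟩ := eventually_atTop.1 hevpos
    have hbdd : BddAbove {s | w s + 1 ≤ 0} := ⟨M, fun s hs => by
      by_contra! h
      exact absurd (hM s h.le) (not_lt.2 hs)⟩
    have hcl : IsClosed {s | w s + 1 ≤ 0} := isClosed_le hucont continuous_const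
    have hmem := hcl.csSup_mem ⟨a, ha⟩ hbdd
    set b := sSup {s | w s + 1 ≤ 0} with hb
    have hgt : ∀ s, b < s → 0 < w s + 1 := fun s hs => by
      by_contra! h
      exact absurd (le_csSup hbdd h) (not_le.2 hs)
    have hdg : ∀ s, HasDerivAt (fun s => (w s + 1) * Real.exp (-(1 / 2 * s)))
        ((w' s - (w s + 1) / 2) * Real.exp (-(1 / 2 * s))) s := fun s => by
      have h1 := (hdu s).mul (((hasDerivAt_id s).const_mul (1 / 2 : ℝ)).neg.exp)
      refine h1.congr_deriv ?_
      simp only [id, Pi.neg_apply]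
      ring
    have hanti : AntitoneOn (fun s => (w s + 1) * Real.exp (-(1 / 2 * s))) (Ici b) := by
      apply antitoneOn_of_deriv_nonpos (convex_Ici b)
      · exact fun s _ => (hdg s).continuousAt.continuousWithinAt
      · exact fun s _ => (hdg s).differentiableAt.differentiableWithinAt
      · intro s hs
        rw [interior_Ici] at hs
        have hs' := hgt s hs
        rw [(hdg s).deriv]
        apply mul_nonpos_of_nonpos_of_nonneg _ (Real.exp_pos _).le
        have h1 : w' s ^ 2 ≤ ((w s + 1) / 2) ^ 2 := by
          rw [hen s]
          have : 0 ≤ (|w s + 1| ^ p * (w s + 1)) / (2 * (p + 1)) := by positivity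
          linarith
        have := abs_le_of_sq_le_sq' h1 (by linarith)
        linarith [this.2]
    have h1 := hanti (mem_Ici.2 le_rfl) (mem_Ici.2 (by linarith : b ≤ b + 1)) (by linarith)
    have h2 := mul_pos (hgt (b + 1) (by linarith)) (Real.exp_pos (-(1 / 2 * (b + 1))))
    have h3 := mul_nonpos_of_nonpos_of_nonneg hmem (Real.exp_pos (-(1 / 2 * b))).le
    simp only at h1
    linarith
  -- linearization
  set y : ℝ → ℝ := fun s => (w s + 1) ^ (-k) with hy
  set z : ℝ → ℝ := fun s => -k * (w s + 1) ^ (-k - 1) * w' s with hz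
  have hypos : ∀ s, 0 < y s := fun s => Real.rpow_pos_of_pos (hpos s) _
  have hdy : ∀ s, HasDerivAt y (z s) s := fun s => by
    have h1 := (hdu s).rpow_const (p := -k) (Or.inl (hpos s).ne')
    refine h1.congr_deriv ?_
    simp only [hz]; ring
  have hq1 : ∀ s, (w s + 1) ^ (-k - 1) * (w s + 1) = y s := fun s => by
    have := (hpos s).ne'
    rw [Real.rpow_sub_one this]
    field_simp
    rfl
  have hq2 : ∀ s, (w s + 1) ^ (-k - 1 - 1) * (w s + 1) ^ 2 = y s := fun s => by
    have := (hpos s).ne'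
    rw [Real.rpow_sub_one this, Real.rpow_sub_one this]
    field_simp
    rfl
  have hq3 : ∀ s, |w s + 1| ^ p = (w s + 1) * ((w s + 1) ^ k) ^ 2 := fun s => by
    rw [abs_of_pos (hpos s), hp, Real.rpow_add (hpos s), Real.rpow_one, mul_comm 2 k,
      Real.rpow_mul (hpos s).le, Real.rpow_two, mul_comm]
  have hq4 : ∀ s, y s * (w s + 1) ^ k = 1 := fun s => by
    simp only [hy]
    rw [← Real.rpow_add (hpos s)]; simp
  have hdz : ∀ s, HasDerivAt z (k ^ 2 / 4 * y s) s := fun s => by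
    have h1 := (((hdu s).rpow_const (p := -k - 1) (Or.inl (hpos s).ne')).const_mul (-k)).mul (hd2 s)
    refine h1.congr_deriv ?_
    have e1 := hen s
    rw [hq3 s, hp] at e1
    have e2 := hw'' s
    rw [hq3 s] at e2
    have e3 : w' s ^ 2 * (k + 1) = (w s + 1) ^ 2 * ((k + 1) / 4 - ((w s + 1) ^ k) ^ 2 / 4) := by
      rw [e1]
      field_simp
      ring
    rw [e2]
    linear_combination k * (w s + 1) ^ (-k - 1 - 1) * e3
      + k * ((k + 1) / 4 - ((w s + 1) ^ k) ^ 2 / 4) * hq2 s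
      - k * (1 / 4 - ((w s + 1) ^ k) ^ 2 / 4) * hq1 s
  have hzy : ∀ s, z s ^ 2 - k ^ 2 / 4 * y s ^ 2 = - (k ^ 2 / (4 * (k + 1))) := fun s => by
    have e1 := hen s
    rw [hq3 s, hp] at e1
    have e3 : w' s ^ 2 = (w s + 1) ^ 2 * (1 / 4 - ((w s + 1) ^ k) ^ 2 / (4 * (k + 1))) := by
      rw [e1]
      field_simp
      ring
    have e4 : z s ^ 2 = k ^ 2 * y s ^ 2 * (1 / 4 - ((w s + 1) ^ k) ^ 2 / (4 * (k + 1))) := by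
      rw [← hq1 s]
      simp only [hz]
      linear_combination k ^ 2 * ((w s + 1) ^ (-k - 1)) ^ 2 * e3
    rw [e4]
    have e5 : y s ^ 2 * ((w s + 1) ^ k) ^ 2 = 1 := by rw [← mul_pow, hq4 s, one_pow]
    linear_combination - (k ^ 2 / (4 * (k + 1))) * e5
  have hdA : ∀ s, HasDerivAt (fun s => (z s + k / 2 * y s) * Real.exp (-(k / 2 * s))) 0 s :=
    fun s => by
      have h1 := ((hdz s).add ((hdy s).const_mul (k / 2))).mul
        (((hasDerivAt_id s).const_mul (k / 2)).neg.exp)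
      refine h1.congr_deriv ?_
      simp only [id, Pi.neg_apply, Pi.add_apply]
      ring
  have hdB : ∀ s, HasDerivAt (fun s => (z s - k / 2 * y s) * Real.exp (k / 2 * s)) 0 s :=
    fun s => by
      have h1 := ((hdz s).sub ((hdy s).const_mul (k / 2))).mul
        (((hasDerivAt_id s).const_mul (k / 2)).exp)
      refine h1.congr_deriv ?_
      simp only [id, Pi.sub_apply]
      ring
  obtain ⟨A, hA⟩ : ∃ A, ∀ s, (z s + k / 2 * y s) * Real.exp (-(k / 2 * s)) = A :=
    ⟨_, fun s => is_const_of_deriv_eq_zero (fun s => (hdA s).differentiableAt)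
      (fun s => (hdA s).deriv) s 0⟩
  obtain ⟨B, hB⟩ : ∃ B, ∀ s, (z s - k / 2 * y s) * Real.exp (k / 2 * s) = B :=
    ⟨_, fun s => is_const_of_deriv_eq_zero (fun s => (hdB s).differentiableAt)
      (fun s => (hdB s).deriv) s 0⟩
  have hAB : A * B < 0 := by
    have a := hA 0
    have b := hB 0
    simp only [mul_zero, neg_zero, Real.exp_zero, mul_one] at a b
    have h1 : A * B = - (k ^ 2 / (4 * (k + 1))) := by
      rw [← hzy 0, ← a, ← b]; ring
    rw [h1]
    have : 0 < k ^ 2 / (4 * (k + 1)) := by positivity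
    linarith
  have hAB' : 0 < A - B := by
    have a := hA 0
    have b := hB 0
    simp only [mul_zero, neg_zero, Real.exp_zero, mul_one] at a b
    have : A - B = k * y 0 := by rw [← a, ← b]; ring
    rw [this]
    exact mul_pos hk (hypos 0)
  have hApos : 0 < A := by
    by_contra! h
    nlinarith
  have hBneg : B < 0 := by
    by_contra! h
    nlinarith
  have hA2 : ∀ s, z s + k / 2 * y s = A * Real.exp (k / 2 * s) := fun s => by
    rw [← hA s, mul_assoc, ← Real.exp_add]; simp
  have hB2 : ∀ s, z s - k / 2 * y s = B * Real.exp (-(k / 2 * s)) := fun s => by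
    rw [← hB s, mul_assoc, ← Real.exp_add]; simp
  have hz2 : ∀ s, 2 * z s = (A * Real.exp (k * s) + B) * Real.exp (-(k / 2 * s)) := fun s => by
    have h1 : Real.exp (k * s) * Real.exp (-(k / 2 * s)) = Real.exp (k / 2 * s) := by
      rw [← Real.exp_add]; congr 1; ring
    linear_combination hA2 s + hB2 s - A * h1
  have hcoef : ∀ s, 0 < k * (w s + 1) ^ (-k - 1) := fun s =>
    mul_pos hk (Real.rpow_pos_of_pos (hpos s) _)
  have hzw : ∀ s, z s = -(k * (w s + 1) ^ (-k - 1) * w' s) := fun s => by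
    simp only [hz]; ring
  have ht1 : A * Real.exp (k * (Real.log (-B / A) / k)) = -B := by
    rw [mul_div_cancel₀ _ hk.ne', Real.exp_log (div_pos (by linarith) hApos)]
    field_simp
  refine ⟨Real.log (-B / A) / k, ?_, ?_, ?_, ?_⟩
  · intro t ht
    have h1 : A * Real.exp (k * (Real.log (-B / A) / k)) < A * Real.exp (k * t) :=
      mul_lt_mul_of_pos_left (Real.exp_lt_exp.2 (mul_lt_mul_of_pos_left ht hk)) hApos
    have h2 : 0 < 2 * z t := by
      rw [hz2]; exact mul_pos (by linarith) (Real.exp_pos _)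
    rw [hzw] at h2
    by_contra! h
    linarith [mul_nonneg (hcoef t).le h]
  · have h2 := hz2 (Real.log (-B / A) / k)
    rw [ht1, neg_add_cancel, zero_mul, hzw] at h2
    have h3 : k * (w (Real.log (-B / A) / k) + 1) ^ (-k - 1) * w' (Real.log (-B / A) / k) = 0 := by
      linarith
    exact (mul_eq_zero.1 h3).resolve_left (hcoef _).ne'
  · intro t ht
    have h1 : A * Real.exp (k * t) < A * Real.exp (k * (Real.log (-B / A) / k)) :=
      mul_lt_mul_of_pos_left (Real.exp_lt_exp.2 (mul_lt_mul_of_pos_left ht hk)) hApos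
    have h2 : 2 * z t < 0 := by
      rw [hz2]; exact mul_neg_of_neg_of_pos (by linarith) (Real.exp_pos _)
    rw [hzw] at h2
    by_contra! h
    linarith [mul_nonpos_of_nonneg_of_nonpos (hcoef t).le h]
  · have hyT : Tendsto y atBot atTop := by
      have h1 : Tendsto (fun s : ℝ => (-B / k) * Real.exp (-(k / 2 * s))) atBot atTop := by
        apply Tendsto.const_mul_atTop (div_pos (by linarith) hk)
        apply Real.tendsto_exp_atTop.comp
        apply tendsto_neg_atBot_atTop.comp
        exact tendsto_id.const_mul_atBot (by positivity)
      refine tendsto_atTop_mono (fun s => ?_) h1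
      have h2 : k * y s = A * Real.exp (k / 2 * s) - B * Real.exp (-(k / 2 * s)) := by
        linear_combination hA2 s - hB2 s
      have h3 : 0 < A * Real.exp (k / 2 * s) := mul_pos hApos (Real.exp_pos _)
      rw [div_mul_eq_mul_div, div_le_iff₀ hk]
      linarith
    have h1 := (tendsto_rpow_neg_atTop (y := 1 / k) (by positivity)).comp hyT
    have h2 := h1.add_const (-1)
    rw [zero_add] at h2
    refine h2.congr fun s => ?_
    simp only [Function.comp, hy]
    rw [← Real.rpow_mul (hpos s).le]
    have : -k * -(1 / k) = 1 := by field_simp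
    rw [this, Real.rpow_one]; ring
end

section
/- Let k > 0, p > 2k + 1, and set θ = k/(p-1). Let V_k(r) = 1/(r^2 (1 - log r)^{2+k}) for 0 < r < e. If v is a C^2 function on (0, e) satisfying v''(r) + v'(r)/r + V_k(r) |v(r)|^p = 0 for all 0 < r < e and v(r) → ∞ as r → 0+, then v(r) = (θ(1-θ))^{1/(p-1)} (1 - log r)^θ for all 0 < r < e. In particular the equation has exactly one singular solution, namely W(r) = (θ(1-θ))^{1/(p-1)} (1 - log r)^θ. -/
open Filter Topology Set MeasureTheory

lemma mono_Ici {f f' : ℝ → ℝ} {T : ℝ} (h : ∀ t, T ≤ t → HasDerivAt f (f' t) t)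
    (h0 : ∀ t, T ≤ t → 0 ≤ f' t) : ∀ a b, T ≤ a → a ≤ b → f a ≤ f b := by
  intro a b ha hab
  have : MonotoneOn f (Ici T) := by
    apply monotoneOn_of_deriv_nonneg (convex_Ici T)
    · exact fun t ht => (h t ht).continuousAt.continuousWithinAt
    · intro t ht
      rw [interior_Ici] at ht
      exact (h t (le_of_lt ht)).differentiableAt.differentiableWithinAt
    · intro t ht
      rw [interior_Ici] at ht
      rw [(h t (le_of_lt ht)).deriv]
      exact h0 t (le_of_lt ht)
  exact this ha (ha.trans hab) hab

lemma barbalat {f f' f'' : ℝ → ℝ} {T M l : ℝ} (h : ∀ t, T ≤ t → HasDerivAt f (f' t) t)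
    (h' : ∀ t, T ≤ t → HasDerivAt f' (f'' t) t) (hM : ∀ t, T ≤ t → |f'' t| ≤ M)
    (hl : Tendsto f atTop (𝓝 l)) : Tendsto f' atTop (𝓝 0) := by
  have hM0 : 0 ≤ M := (abs_nonneg _).trans (hM T le_rfl)
  rw [Metric.tendsto_atTop]
  intro ε hε
  obtain ⟨d, hd, hdM⟩ : ∃ d : ℝ, 0 < d ∧ M * d ≤ ε / 2 := by
    refine ⟨ε / (2 * (M + 1)), by positivity, ?_⟩
    rw [mul_div_assoc', div_le_div_iff₀ (by positivity) (by positivity)]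
    nlinarith
  have h2 : Tendsto (fun t => f (t + d) - f t) atTop (𝓝 (l - l)) :=
    (hl.comp (tendsto_atTop_add_const_right _ d tendsto_id)).sub hl
  rw [sub_self, Metric.tendsto_atTop] at h2
  obtain ⟨N, hN⟩ := h2 (d * (ε / 2)) (by positivity)
  refine ⟨max N T, fun t ht => ?_⟩
  have htT : T ≤ t := (le_max_right _ _).trans ht
  have h3 := hN t ((le_max_left _ _).trans ht)
  rw [Real.dist_eq, sub_zero] at h3 ⊢
  obtain ⟨c, hc, hce⟩ := exists_hasDerivAt_eq_slope f f' (show t < t + d by linarith)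
    (fun x hx => (h x (htT.trans hx.1)).continuousAt.continuousWithinAt)
    (fun x hx => h x (htT.trans hx.1.le))
  have h4 : |f' c| < ε / 2 := by
    rw [hce, add_sub_cancel_left, abs_div, abs_of_pos hd, div_lt_iff₀ hd]
    linarith
  have h5 := Convex.norm_image_sub_le_of_norm_hasDerivWithin_le (f := f') (f' := f'') (C := M)
    (s := Ici T) (x := t) (y := c) (fun x hx => (h' x hx).hasDerivWithinAt)
    (fun x hx => hM x hx) (convex_Ici T) htT (htT.trans hc.1.le)
  rw [Real.norm_eq_abs, Real.norm_eq_abs, abs_of_pos (sub_pos.2 hc.1)] at h5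
  have h6 : M * (c - t) ≤ M * d := mul_le_mul_of_nonneg_left (by linarith [hc.2]) hM0
  have h7 : |f' t| ≤ |f' c| + |f' c - f' t| := by
    have := abs_sub_abs_le_abs_sub (f' t) (f' c)
    rw [abs_sub_comm] at this
    linarith
  linarith

/-- strict minimum -/
lemma pot_min {p b x m : ℝ} (hp : 1 < p) (hb : 0 < b) (hm : 0 < m) (hmb : m ^ p = b * m)
    (hx : 0 < x) (h : -b * x ^ 2 / 2 + x ^ p * x / (p + 1) ≤ -b * m ^ 2 / 2 + m ^ p * m / (p + 1)) :
    x = m := by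
  by_contra hne
  obtain ⟨ρ, hρ, rfl⟩ : ∃ ρ, 0 < ρ ∧ x = m * ρ := ⟨x / m, by positivity, by field_simp⟩
  have hρ1 : ρ ≠ 1 := by rintro rfl; simp at hne
  have hs : ρ ^ 2 - 1 ≠ 0 := by
    intro h0
    have : (ρ - 1) * (ρ + 1) = 0 := by linarith
    rcases mul_eq_zero.1 this with h1 | h1
    · exact hρ1 (by linarith)
    · linarith
  have hB := one_add_mul_self_lt_rpow_one_add (s := ρ ^ 2 - 1) (by nlinarith [sq_nonneg ρ]) hs
    (p := (p + 1) / 2) (by linarith)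
  have e1 : (1 + (ρ ^ 2 - 1)) ^ ((p + 1) / 2) = ρ ^ p * ρ := by
    rw [add_sub_cancel, ← Real.rpow_natCast, ← Real.rpow_mul hρ.le]
    rw [← Real.rpow_add_one hρ.ne']
    congr 1
    push_cast; ring
  rw [e1] at hB
  rw [Real.mul_rpow hm.le hρ.le, hmb] at h
  have e2 : b * m * ρ ^ p * (m * ρ) / (p + 1) = b * m ^ 2 * (ρ ^ p * ρ / (p + 1)) := by ring
  have hB' : 1 / (p + 1) + (ρ ^ 2 - 1) / 2 < ρ ^ p * ρ / (p + 1) := by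
    rw [lt_div_iff₀ (by linarith)]
    have : (1 / (p + 1) + (ρ ^ 2 - 1) / 2) * (p + 1) = 1 + (p + 1) / 2 * (ρ ^ 2 - 1) := by
      field_simp
    linarith
  have h8 := mul_lt_mul_of_pos_left hB' (show 0 < b * m ^ 2 by positivity)
  rw [e2] at h
  have e3 : b * m * m / (p + 1) = b * m ^ 2 * (1 / (p + 1)) := by ring
  rw [e3] at h
  nlinarith

lemma zero_case {L Q y : ℝ → ℝ} {T k p θ : ℝ} (hk : 0 < k) (hp : 2 * k + 1 < p)
    (hθ : θ * (p - 1) = k)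
    (hL : ∀ t, T ≤ t → HasDerivAt L (Q t) t)
    (hQ : ∀ t, T ≤ t → HasDerivAt Q (Q t - Q t ^ 2 - y t) t)
    (hy : ∀ t, T ≤ t → HasDerivAt y ((p - 1) * y t * (Q t - θ)) t)
    (hQ0 : ∀ t, T ≤ t → 0 ≤ Q t) (hQ1 : ∀ t, T ≤ t → Q t ≤ 1) (hy0 : ∀ t, T ≤ t → 0 < y t)
    (hLt : Tendsto L atTop atTop) (hyt : Tendsto y atTop (𝓝 0)) : False := by
  have hp1 : 0 < p - 1 := by linarith
  have hθ0 : 0 < θ := by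
    by_contra h
    nlinarith
  have hθ1 : θ < 1 / 2 := by
    by_contra h
    nlinarith
  by_cases hc : ∃ T', ∀ t, T' ≤ t → Q t ≤ θ / 2
  · obtain ⟨T', hT'⟩ := hc
    have hmono := mono_Ici (T := max T T') (f := fun t => -(L t + 4 / k * y t - 2 * Q t))
      (f' := fun t => -(Q t + 4 / k * ((p - 1) * y t * (Q t - θ)) - 2 * (Q t - Q t ^ 2 - y t)))
      (fun t ht => by
        have h1 := (le_max_left _ _).trans ht
        exact (((hL t h1).add ((hy t h1).const_mul _)).sub ((hQ t h1).const_mul _)).neg)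
      (fun t ht => by
        have h1 := (le_max_left _ _).trans ht
        have h2 := hT' t ((le_max_right _ _).trans ht)
        have h3 := hQ0 t h1
        have h4 := hy0 t h1
        have h5 : 4 / k * ((p - 1) * y t * (Q t - θ)) ≤ - 2 * y t := by
          have : 4 / k * ((p - 1) * y t * (Q t - θ)) = y t * (4 * ((p - 1) * Q t - k) / k) := by
            rw [← hθ]; ring
          rw [this]
          have h6 : 4 * ((p - 1) * Q t - k) / k ≤ -2 := by
            rw [div_le_iff₀ hk]; nlinarith
          nlinarith
        nlinarith)
    obtain ⟨N, hN⟩ := ((hLt.eventually_gt_atTop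
      (L (max T T') + 4 / k * y (max T T') - 2 * Q (max T T') + 2)).and
      (eventually_ge_atTop (max T T'))).exists
    have h1 := hmono _ _ le_rfl hN.2
    have h2 := hQ1 N ((le_max_left _ _).trans hN.2)
    have h3 := hy0 N ((le_max_left _ _).trans hN.2)
    have h4 : 0 < 4 / k * y N := by positivity
    linarith [hN.1]
  · push Not at hc
    have hev : ∀ᶠ t in atTop, y t < θ / 2 * (1 - θ) :=
      hyt.eventually_lt_const (by apply mul_pos <;> linarith)
    obtain ⟨T', hT'⟩ := eventually_atTop.1 hev
    obtain ⟨t0, ht0, hQt0⟩ := hc (max T T')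
    have hT0 : T ≤ t0 := (le_max_left _ _).trans ht0
    have hT1 : T' ≤ t0 := (le_max_right _ _).trans ht0
    have hQl : ∀ t, t0 ≤ t → θ / 2 ≤ Q t := by
      intro t ht
      have := image_le_of_deriv_right_lt_deriv_boundary (a := t0) (b := t) (f := fun t => - Q t)
        (f' := fun t => -(Q t - Q t ^ 2 - y t)) (B := fun _ => -(θ / 2)) (B' := fun _ => 0)
        (fun x hx => (hQ x (hT0.trans hx.1)).neg.continuousAt.continuousWithinAt)
        (fun x hx => (hQ x (hT0.trans hx.1)).neg.hasDerivWithinAt)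
        (by linarith) (fun x => hasDerivAt_const _ _)
        (fun x hx he => by
          have he' : Q x = θ / 2 := by linarith
          have := hT' x (hT1.trans hx.1)
          simp only [he']
          nlinarith) ⟨ht, le_rfl⟩
      linarith
    have hmono := mono_Ici (T := t0) (f := fun t => Real.log (y t) + (p - 1) / (θ / 2) * Q t)
      (f' := fun t => ((p - 1) * y t * (Q t - θ)) / y t +
        (p - 1) / (θ / 2) * (Q t - Q t ^ 2 - y t))
      (fun t ht => ((hy t (hT0.trans ht)).log (hy0 t (hT0.trans ht)).ne').add
        ((hQ t (hT0.trans ht)).const_mul _))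
      (fun t ht => by
        have h4 := hy0 t (hT0.trans ht)
        have h1 := hQl t ht
        have h2 := hQ1 t (hT0.trans ht)
        have h3 := hT' t (hT1.trans ht)
        have e : ((p - 1) * y t * (Q t - θ)) / y t = (p - 1) / (θ / 2) * (θ / 2 * (Q t - θ)) := by
          field_simp
        rw [e, ← mul_add]
        apply mul_nonneg (by positivity)
        nlinarith)
    have hlog : Tendsto (fun t => Real.log (y t)) atTop atBot := by
      apply Real.tendsto_log_nhdsGT_zero.comp
      rw [tendsto_nhdsWithin_iff]
      exact ⟨hyt, eventually_atTop.2 ⟨T, fun t ht => hy0 t ht⟩⟩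
    obtain ⟨N, hN⟩ := ((hlog.eventually_lt_atBot
      (Real.log (y t0) + (p - 1) / (θ / 2) * Q t0 - (p - 1) / (θ / 2))).and
      (eventually_ge_atTop t0)).exists
    have h1 := hmono _ _ le_rfl hN.2
    have h2 := hQ1 N (hT0.trans hN.2)
    have h3 : (p - 1) / (θ / 2) * Q N ≤ (p - 1) / (θ / 2) * 1 :=
      mul_le_mul_of_nonneg_left h2 (by positivity)
    linarith [hN.1]

lemma lasalle {w w1 : ℝ → ℝ} {a b p T C : ℝ} (hp : 1 < p) (ha : 0 < a) (hb : 0 < b)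
    (hw : ∀ t, HasDerivAt w (w1 t) t)
    (hw1 : ∀ t, HasDerivAt w1 (a * w1 t + b * w t - |w t| ^ p) t)
    (hpos : ∀ t, T ≤ t → 0 < w t) (hC : ∀ t, T ≤ t → w t ≤ C) (hC1 : ∀ t, T ≤ t → |w1 t| ≤ C)
    (hnz : ¬ Tendsto w atTop (𝓝 0)) : ∀ t, w t = b ^ (1 / (p - 1)) := by
  have hp0 : p ≠ 0 := by linarith
  have hC0 : 0 ≤ C := (abs_nonneg _).trans (hC1 T le_rfl)
  set E : ℝ → ℝ := fun t => w1 t ^ 2 / 2 + (-b * w t ^ 2 / 2 + |w t| ^ p * w t / (p + 1)) with hE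
  have hEd : ∀ t, HasDerivAt E (a * w1 t ^ 2) t := by
    intro t
    have h1 := (((hw1 t).pow 2).div_const 2).add (((((hw t).pow 2).const_mul (-b)).div_const 2).add
      ((((hasDerivAt_abs_rpow (w t) hp).comp t (hw t)).mul (hw t)).div_const (p + 1)))
    refine h1.congr_deriv ?_
    have e : |w t| ^ (p - 2) * w t * w t = |w t| ^ p := by
      rcases eq_or_ne (w t) 0 with h0 | h0
      · simp [h0, Real.zero_rpow hp0]
      · rw [mul_assoc, ← sq, ← sq_abs, ← Real.rpow_natCast |w t| 2,
          ← Real.rpow_add (abs_pos.2 h0)]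
        congr 1; push_cast; ring
    have e2 : (p * |w t| ^ (p - 2) * w t * w1 t * w t + |w t| ^ p * w1 t) / (p + 1)
        = |w t| ^ p * w1 t := by
      rw [div_eq_iff (by linarith), ← e]; ring
    simp only [Function.comp]
    rw [e2]
    push_cast
    ring
  have hEm : Monotone E := by
    intro x z hxz
    exact mono_Ici (T := x) (fun t _ => hEd t) (fun t _ => by positivity) x z le_rfl hxz
  have hwp : ∀ t, T ≤ t → |w t| ^ p ≤ C ^ p := fun t ht => by
    rw [abs_of_pos (hpos t ht)]
    exact Real.rpow_le_rpow (hpos t ht).le (hC t ht) (by linarith)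
  have hEb : BddAbove (range E) := by
    refine ⟨C ^ 2 / 2 + (C ^ p * C / (p + 1)), ?_⟩
    rintro _ ⟨t, rfl⟩
    refine (hEm (le_max_left t T)).trans ?_
    have ht := le_max_right t T
    have h1 : w1 (max t T) ^ 2 ≤ C ^ 2 := by
      rw [← sq_abs]
      exact pow_le_pow_left₀ (abs_nonneg _) (hC1 _ ht) 2
    have h2 : |w (max t T)| ^ p * w (max t T) / (p + 1) ≤ C ^ p * C / (p + 1) := by
      apply div_le_div_of_nonneg_right _ (by linarith)
      exact mul_le_mul (hwp _ ht) (hC _ ht) (hpos _ ht).le (by positivity)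
    have h3 : 0 ≤ b * w (max t T) ^ 2 := by positivity
    simp only [hE]
    linarith
  obtain ⟨l, hl⟩ : ∃ l, Tendsto E atTop (𝓝 l) := ⟨_, tendsto_atTop_ciSup hEm hEb⟩
  have hEl : ∀ t, E t ≤ l := fun t => hEm.ge_of_tendsto hl t
  -- bounds on second derivative
  set D := a * C + b * C + C ^ p with hD
  have hD0 : 0 ≤ D := by positivity
  have hw2 : ∀ t, T ≤ t → |a * w1 t + b * w t - |w t| ^ p| ≤ D := by
    intro t ht
    have h1 := abs_le.1 (hC1 t ht)
    have h2 := hC t ht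
    have h3 := hpos t ht
    have h4 := hwp t ht
    have h5 : 0 ≤ |w t| ^ p := by positivity
    have h6 : 0 ≤ C ^ p := by positivity
    rw [abs_le, hD]
    constructor <;> nlinarith
  have hlim1 : Tendsto (fun t => a * w1 t ^ 2) atTop (𝓝 0) := by
    refine barbalat (T := T) (M := 2 * a * (C * D)) (fun t _ => hEd t)
      (f'' := fun t => 2 * a * (w1 t * (a * w1 t + b * w t - |w t| ^ p)))
      (fun t _ => (((hw1 t).pow 2).const_mul a).congr_deriv (by push_cast; ring)) ?_ hl
    intro t ht
    rw [abs_mul (2 * a), abs_mul (w1 t), abs_of_pos (show 0 < 2 * a by positivity)]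
    exact mul_le_mul_of_nonneg_left
      (mul_le_mul (hC1 t ht) (hw2 t ht) (abs_nonneg _) hC0) (by positivity)
  have hlimw1 : Tendsto w1 atTop (𝓝 0) := by
    have h1 : Tendsto (fun t => Real.sqrt ((a * w1 t ^ 2) / a)) atTop (𝓝 (Real.sqrt (0 / a))) :=
      (hlim1.div_const a).sqrt
    simp only [zero_div, Real.sqrt_zero, mul_div_cancel_left₀ _ ha.ne', Real.sqrt_sq_eq_abs] at h1
    exact (tendsto_zero_iff_abs_tendsto_zero _).2 h1
  have hlimw2 : Tendsto (fun t => a * w1 t + b * w t - |w t| ^ p) atTop (𝓝 0) := by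
    refine barbalat (T := T) (M := a * D + b * C + p * (C ^ (p - 1) * C)) (fun t _ => hw1 t)
      (f'' := fun t => a * (a * w1 t + b * w t - |w t| ^ p) + b * w1 t
        - p * (|w t| ^ (p - 2) * w t * w1 t))
      (fun t _ => ((((hw1 t).const_mul a).add ((hw t).const_mul b)).sub
        ((hasDerivAt_abs_rpow (w t) hp).comp t (hw t))).congr_deriv (by ring)) ?_ hlimw1
    intro t ht
    have h0 := hpos t ht
    have e : |w t| ^ (p - 2) * w t = w t ^ (p - 1) := by
      rw [abs_of_pos h0, ← Real.rpow_add_one h0.ne']; congr 1; ring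
    rw [e]
    have i1 : |a * (a * w1 t + b * w t - |w t| ^ p)| ≤ a * D := by
      rw [abs_mul, abs_of_pos ha]; exact mul_le_mul_of_nonneg_left (hw2 t ht) ha.le
    have i2 : |b * w1 t| ≤ b * C := by
      rw [abs_mul, abs_of_pos hb]; exact mul_le_mul_of_nonneg_left (hC1 t ht) hb.le
    have i3 : |p * (w t ^ (p - 1) * w1 t)| ≤ p * (C ^ (p - 1) * C) := by
      rw [abs_mul, abs_mul, abs_of_pos (show 0 < p by linarith),
        abs_of_pos (show 0 < w t ^ (p - 1) by positivity)]
      apply mul_le_mul_of_nonneg_left _ (by linarith)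
      exact mul_le_mul (Real.rpow_le_rpow h0.le (hC t ht) (by linarith)) (hC1 t ht)
        (abs_nonneg _) (by positivity)
    refine (abs_sub _ _).trans (add_le_add ((abs_add_le _ _).trans (add_le_add i1 i2)) i3)
  have hlim3 : Tendsto (fun t => b * w t - |w t| ^ p) atTop (𝓝 0) := by
    have := hlimw2.sub (hlimw1.const_mul a)
    simp only [mul_zero, sub_zero] at this
    refine this.congr fun t => by ring
  have hlim4 : Tendsto (fun t => w t * (b * w t - |w t| ^ p)) atTop (𝓝 0) := by
    refine bdd_le_mul_tendsto_zero' C ?_ hlim3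
    filter_upwards [eventually_ge_atTop T] with t ht
    rw [abs_of_pos (hpos t ht)]; exact hC t ht
  have hlimsq : ∃ m, Tendsto (fun t => w t ^ 2) atTop (𝓝 m) := by
    have h1 := (((hlimw1.pow 2).const_mul ((p + 1) / 2)).sub hlim4).sub (hl.const_mul (p + 1))
    have h2 := h1.div_const (b * (p - 1) / 2)
    refine ⟨_, h2.congr fun t => ?_⟩
    have hp1 : p - 1 ≠ 0 := by linarith
    have hp2 : p + 1 ≠ 0 := by linarith
    simp only [hE]
    field_simp
    ring
  obtain ⟨m, hm⟩ := hlimsq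
  have hwl : Tendsto w atTop (𝓝 (Real.sqrt m)) := by
    refine hm.sqrt.congr' ?_
    filter_upwards [eventually_ge_atTop T] with t ht
    exact Real.sqrt_sq (hpos t ht).le
  set q := Real.sqrt m with hq
  have hq0 : 0 ≤ q := Real.sqrt_nonneg _
  have hqne : q ≠ 0 := fun h => hnz (h ▸ hwl)
  have hqpos : 0 < q := lt_of_le_of_ne hq0 hqne.symm
  have habs : Tendsto (fun t => |w t| ^ p) atTop (𝓝 (q ^ p)) := by
    have := hwl.abs.rpow_const (p := p) (Or.inr (by linarith))
    rwa [abs_of_pos hqpos] at this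
  have hqp : q ^ p = b * q := by
    have := tendsto_nhds_unique hlim3 ((hwl.const_mul b).sub habs)
    linarith
  have hlq : l = -b * q ^ 2 / 2 + q ^ p * q / (p + 1) := by
    have h1 := ((hlimw1.pow 2).div_const 2).add ((((hwl.pow 2).const_mul (-b)).div_const 2).add
      ((habs.mul hwl).div_const (p + 1)))
    have := tendsto_nhds_unique hl h1
    simpa using this
  have hdich : ∀ t, 0 < w t → w t = q := by
    intro t ht
    apply pot_min hp hb hqpos hqp ht
    rw [← hlq]
    refine le_trans ?_ (hEl t)
    simp only [hE]
    rw [abs_of_pos ht]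
    have : 0 ≤ w1 t ^ 2 / 2 := by positivity
    linarith
  have hqb : q = b ^ (1 / (p - 1)) := by
    have h1 : q ^ (p - 1) = b := by
      rw [Real.rpow_sub_one hqne, hqp]; field_simp
    rw [← h1, ← Real.rpow_mul hq0, mul_one_div_cancel (by linarith), Real.rpow_one]
  intro t
  rw [← hqb]
  by_contra hne
  have hle : w t ≤ 0 := by
    by_contra h
    exact hne (hdich t (not_le.1 h))
  have hcont : Continuous w := continuous_iff_continuousAt.2 fun t => (hw t).continuousAt
  have hmem : q / 2 ∈ range w := by
    apply mem_range_of_exists_le_of_exists_ge hcont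
    · exact ⟨t, by linarith⟩
    · exact ⟨T, by rw [hdich T (hpos T le_rfl)]; linarith⟩
  obtain ⟨x, hx⟩ := hmem
  have := hdich x (by rw [hx]; linarith)
  linarith

lemma prelim {U U1 : ℝ → ℝ} {k p : ℝ} (hk : 0 < k) (hp : 2 * k + 1 < p)
    (hU : ∀ t, HasDerivAt U (U1 t) t)
    (hU1 : ∀ t, HasDerivAt U1 (U1 t - Real.exp (-k * t) * |U t| ^ p) t)
    (hUt : Tendsto U atTop atTop) :
    ∃ T, ∀ t, T ≤ t → 0 < U t ∧ 0 ≤ U1 t ∧ U1 t ≤ U t ∧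
      Real.exp (-k * t) * U t ^ p ≤ (1 + k) * U1 t := by
  have hX : ∀ t, HasDerivAt (fun t => Real.exp (-t) * U1 t)
      (-(Real.exp (-t) * (Real.exp (-k * t) * |U t| ^ p))) t := by
    intro t
    refine (((hasDerivAt_neg t).exp).mul (hU1 t)).congr_deriv ?_
    ring
  have hXm : ∀ s t, s ≤ t → Real.exp (-t) * U1 t ≤ Real.exp (-s) * U1 s := by
    intro s t hst
    have := mono_Ici (T := s) (fun t _ => (hX t).neg) (fun t _ => by
      rw [neg_neg]; positivity) s t le_rfl hst
    simp only [Pi.neg_apply] at this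
    linarith
  have hU1n : ∀ t, 0 ≤ U1 t := by
    intro t1
    by_contra hneg
    push Not at hneg
    have hle : ∀ t, t1 ≤ t → U1 t ≤ 0 := by
      intro t ht
      by_contra h
      push Not at h
      have h1 := hXm _ _ ht
      have h2 : 0 < Real.exp (-t) * U1 t := by positivity
      have h3 : Real.exp (-t1) * U1 t1 < 0 := mul_neg_of_pos_of_neg (Real.exp_pos _) hneg
      linarith
    obtain ⟨N, hN, hN'⟩ := ((hUt.eventually_gt_atTop (U t1)).and (eventually_ge_atTop t1)).exists
    have := mono_Ici (T := t1) (fun t _ => (hU t).neg) (fun t ht => by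
      linarith [hle t ht]) t1 N le_rfl hN'
    simp only [Pi.neg_apply] at this
    linarith
  have hUm : ∀ s t, s ≤ t → U s ≤ U t := fun s t hst =>
    mono_Ici (T := s) (fun t _ => hU t) (fun t _ => hU1n t) s t le_rfl hst
  have hD : ∀ s t, s ≤ t → U s - U1 s ≤ U t - U1 t := fun s t hst =>
    mono_Ici (T := s) (f := fun t => U t - U1 t) (fun t _ => (hU t).sub (hU1 t)) (fun t _ => by
      have : 0 ≤ Real.exp (-k * t) * |U t| ^ p := by positivity
      linarith) s t le_rfl hst
  obtain ⟨T0, hT0⟩ := eventually_atTop.1 (hUt.eventually_gt_atTop 0)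
  -- lower bound of derivative
  have hlow : ∀ t, T0 ≤ t → Real.exp (-k * t) * U t ^ p ≤ (1 + k) * U1 t := by
    intro t ht
    have hUp := hT0 t ht
    have hmono := mono_Ici (T := t)
      (f := fun τ => -(Real.exp (-τ) * U1 τ - U t ^ p / (1 + k) * Real.exp (-(1 + k) * τ)))
      (f' := fun τ => -(-(Real.exp (-τ) * (Real.exp (-k * τ) * |U τ| ^ p)) -
        U t ^ p / (1 + k) * (Real.exp (-(1 + k) * τ) * (-(1 + k) * 1))))
      (fun τ _ => ((hX τ).sub ((((hasDerivAt_id τ).const_mul (-(1 + k))).exp).const_mul _)).neg)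
      (fun τ hτ => by
        have e1 : Real.exp (-(1 + k) * τ) = Real.exp (-τ) * Real.exp (-k * τ) := by
          rw [← Real.exp_add]; congr 1; ring
        have e2 : U t ^ p ≤ |U τ| ^ p :=
          Real.rpow_le_rpow hUp.le ((hUm t τ hτ).trans (le_abs_self _)) (by linarith)
        rw [e1]
        have e3 : -(-(Real.exp (-τ) * (Real.exp (-k * τ) * |U τ| ^ p)) -
          U t ^ p / (1 + k) * (Real.exp (-τ) * Real.exp (-k * τ) * (-(1 + k) * 1))) =
          Real.exp (-τ) * Real.exp (-k * τ) * (|U τ| ^ p - U t ^ p) := by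
          field_simp; ring
        rw [e3]
        exact mul_nonneg (by positivity) (by linarith))
    have hlim : Tendsto (fun τ => - (U t ^ p / (1 + k) * Real.exp (-(1 + k) * τ))) atTop
        (𝓝 (-(U t ^ p / (1 + k) * 0))) := by
      apply Tendsto.neg
      apply Tendsto.const_mul
      apply Real.tendsto_exp_atBot.comp
      exact tendsto_id.const_mul_atTop_of_neg (by linarith)
    rw [mul_zero, neg_zero] at hlim
    have h0 : 0 ≤ Real.exp (-t) * U1 t - U t ^ p / (1 + k) * Real.exp (-(1 + k) * t) := by
      refine le_of_tendsto hlim ?_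
      filter_upwards [eventually_ge_atTop t] with τ hτ
      have h1 := hmono t τ le_rfl hτ
      have h2 : 0 ≤ Real.exp (-τ) * U1 τ := mul_nonneg (Real.exp_pos _).le (hU1n τ)
      linarith
    have e1 : Real.exp (-(1 + k) * t) = Real.exp (-t) * Real.exp (-k * t) := by
      rw [← Real.exp_add]; congr 1; ring
    rw [e1] at h0
    have h1 : 0 ≤ Real.exp (-t) * (U1 t - U t ^ p / (1 + k) * Real.exp (-k * t)) := by
      linarith
    have h2 := (mul_nonneg_iff_of_pos_left (Real.exp_pos _)).1 h1
    have e4 : Real.exp (-k * t) * U t ^ p =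
      (1 + k) * (U t ^ p / (1 + k) * Real.exp (-k * t)) := by field_simp
    rw [e4]
    exact mul_le_mul_of_nonneg_left (by linarith) (by linarith)
  -- U1 ≤ U somewhere
  have hex : ∃ t1, U1 t1 ≤ U t1 := by
    by_contra hcon
    push Not at hcon
    obtain ⟨T1, hT1⟩ := eventually_atTop.1 (hUt.eventually_gt_atTop (U1 T0 - U T0))
    have hc := hT0 T0 le_rfl
    set c := Real.exp (-T0) * U T0 with hcdef
    have hc0 : 0 < c := by positivity
    have hgrow : ∀ t, T0 ≤ t → c * Real.exp t ≤ U t := by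
      intro t ht
      have := mono_Ici (T := T0) (f := fun t => Real.exp (-t) * U t)
        (fun t _ => ((hasDerivAt_neg t).exp).mul (hU t)) (fun t _ => by
          have h1 := hcon t
          have h2 := Real.exp_pos (-t)
          nlinarith) T0 t le_rfl ht
      have h3 := mul_le_mul_of_nonneg_right this (Real.exp_pos t).le
      have e : Real.exp (-t) * U t * Real.exp t = U t := by
        rw [mul_right_comm, ← Real.exp_add]; simp
      rw [e] at h3
      exact h3
    have hub : ∀ t, max T0 T1 ≤ t → U t ^ (p - 1) ≤ 2 * (1 + k) * Real.exp (k * t) := by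
      intro t ht
      have h0 := (le_max_left _ _).trans ht
      have h1 := hlow t h0
      have h2 := hD T0 t h0
      have h3 := hT1 t ((le_max_right _ _).trans ht)
      have h4 := hT0 t h0
      have h5 : U1 t ≤ 2 * U t := by linarith
      have h6 : Real.exp (-k * t) * U t ^ p ≤ (1 + k) * (2 * U t) :=
        h1.trans (mul_le_mul_of_nonneg_left h5 (by linarith))
      rw [Real.rpow_sub_one h4.ne', div_le_iff₀ h4]
      have h7 := mul_le_mul_of_nonneg_left h6 (Real.exp_pos (k * t)).le
      have e : Real.exp (k * t) * (Real.exp (-k * t) * U t ^ p) = U t ^ p := by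
        rw [← mul_assoc, ← Real.exp_add]; simp
      rw [e] at h7
      linarith
    have hlim : Tendsto (fun t => c ^ (p - 1) * Real.exp ((p - 1 - k) * t)) atTop atTop := by
      apply Tendsto.const_mul_atTop (by positivity)
      apply Real.tendsto_exp_atTop.comp
      exact tendsto_id.const_mul_atTop (by linarith)
    obtain ⟨N, hN, hN'⟩ := ((hlim.eventually_gt_atTop (2 * (1 + k))).and
      (eventually_ge_atTop (max T0 T1))).exists
    have h1 := hub N hN'
    have h2 := hgrow N ((le_max_left _ _).trans hN')
    have h3 : (c * Real.exp N) ^ (p - 1) ≤ U N ^ (p - 1) :=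
      Real.rpow_le_rpow (by positivity) h2 (by linarith)
    rw [Real.mul_rpow hc0.le (Real.exp_pos _).le, ← Real.exp_mul] at h3
    have h4 := mul_lt_mul_of_pos_right hN (Real.exp_pos (k * N))
    rw [mul_assoc (c ^ (p - 1)), ← Real.exp_add] at h4
    have e : (p - 1 - k) * N + k * N = N * (p - 1) := by ring
    rw [e] at h4
    linarith
  obtain ⟨t1, ht1⟩ := hex
  refine ⟨max T0 t1, fun t ht => ?_⟩
  have h0 := (le_max_left _ _).trans ht
  have h1 := hD t1 t ((le_max_right _ _).trans ht)
  exact ⟨hT0 t h0, hU1n t, by linarith, hlow t h0⟩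

lemma main_t {U U1 : ℝ → ℝ} {k p θ : ℝ} (hk : 0 < k) (hp : 2 * k + 1 < p)
    (hθ : θ * (p - 1) = k)
    (hU : ∀ t, HasDerivAt U (U1 t) t)
    (hU1 : ∀ t, HasDerivAt U1 (U1 t - Real.exp (-k * t) * |U t| ^ p) t)
    (hUt : Tendsto U atTop atTop) (t : ℝ) :
    U t = (θ * (1 - θ)) ^ (1 / (p - 1)) * Real.exp (θ * t) := by
  have hp1 : 0 < p - 1 := by linarith
  have hθ0 : 0 < θ := by
    by_contra h
    nlinarith
  have hθ1 : θ < 1 / 2 := by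
    by_contra h
    nlinarith
  obtain ⟨T, hT⟩ := prelim hk hp hU hU1 hUt
  have hexp : ∀ t, HasDerivAt (fun t => Real.exp (-θ * t)) (-θ * Real.exp (-θ * t)) t := by
    intro t
    refine (((hasDerivAt_id t).const_mul (-θ)).exp).congr_deriv ?_
    simp only [id]; ring
  have hw : ∀ t, HasDerivAt (fun t => Real.exp (-θ * t) * U t)
      (Real.exp (-θ * t) * (U1 t - θ * U t)) t := fun t =>
    ((hexp t).mul (hU t)).congr_deriv (by ring)
  have hwabs : ∀ t, |Real.exp (-θ * t) * U t| ^ p =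
      Real.exp (-θ * t) * (Real.exp (-k * t) * |U t| ^ p) := by
    intro t
    rw [abs_mul, abs_of_pos (Real.exp_pos _), Real.mul_rpow (Real.exp_pos _).le (abs_nonneg _),
      ← Real.exp_mul, ← mul_assoc, ← Real.exp_add]
    congr 2
    rw [← hθ]; ring
  have hw1 : ∀ t, HasDerivAt (fun t => Real.exp (-θ * t) * (U1 t - θ * U t))
      ((1 - 2 * θ) * (Real.exp (-θ * t) * (U1 t - θ * U t)) +
        θ * (1 - θ) * (Real.exp (-θ * t) * U t) - |Real.exp (-θ * t) * U t| ^ p) t := fun t => by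
    rw [hwabs]
    exact ((hexp t).mul ((hU1 t).sub ((hU t).const_mul θ))).congr_deriv (by simp only [Pi.sub_apply]; ring)
  have hwp1 : ∀ t, T ≤ t → (Real.exp (-θ * t) * U t) ^ (p - 1) =
      Real.exp (-k * t) * U t ^ (p - 1) := by
    intro t ht
    rw [Real.mul_rpow (Real.exp_pos _).le (hT t ht).1.le, ← Real.exp_mul]
    congr 2
    rw [← hθ]; ring
  have hyb : ∀ t, T ≤ t → Real.exp (-k * t) * U t ^ (p - 1) ≤ 1 + k := by
    intro t ht
    obtain ⟨h0, h1, h2, h3⟩ := hT t ht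
    rw [Real.rpow_sub_one h0.ne', ← mul_div_assoc, div_le_iff₀ h0]
    exact h3.trans (mul_le_mul_of_nonneg_left h2 (by linarith))
  have hC : ∀ t, T ≤ t → Real.exp (-θ * t) * U t ≤ (1 + k) ^ (1 / (p - 1)) := by
    intro t ht
    have h0 : 0 ≤ Real.exp (-θ * t) * U t := mul_nonneg (Real.exp_pos _).le (hT t ht).1.le
    have h1 := hyb t ht
    rw [← hwp1 t ht] at h1
    have h2 := Real.rpow_le_rpow (Real.rpow_nonneg h0 _) h1 (show 0 ≤ 1 / (p - 1) by positivity)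
    rwa [← Real.rpow_mul h0, mul_one_div_cancel hp1.ne', Real.rpow_one] at h2
  have key := lasalle (w := fun t => Real.exp (-θ * t) * U t)
    (w1 := fun t => Real.exp (-θ * t) * (U1 t - θ * U t)) (a := 1 - 2 * θ) (b := θ * (1 - θ))
    (p := p) (T := T) (C := (1 + k) ^ (1 / (p - 1))) (by linarith) (by linarith)
    (by apply mul_pos <;> linarith) hw hw1
    (fun t ht => mul_pos (Real.exp_pos _) (hT t ht).1) hC
    (fun t ht => by
      refine le_trans ?_ (hC t ht)
      obtain ⟨h0, h1, h2, h3⟩ := hT t ht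
      rw [abs_mul, abs_of_pos (Real.exp_pos _)]
      apply mul_le_mul_of_nonneg_left _ (Real.exp_pos _).le
      rw [abs_le]
      constructor <;> nlinarith)
    (fun hz => by
      refine zero_case (L := fun t => Real.log (U t)) (Q := fun t => U1 t / U t)
        (y := fun t => Real.exp (-k * t) * U t ^ (p - 1)) (T := T) hk hp hθ
        (fun t ht => (hU t).log (hT t ht).1.ne') ?_ ?_
        (fun t ht => div_nonneg (hT t ht).2.1 (hT t ht).1.le)
        (fun t ht => (div_le_one (hT t ht).1).2 (hT t ht).2.2.1)
        (fun t ht => mul_pos (Real.exp_pos _) (Real.rpow_pos_of_pos (hT t ht).1 _))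
        (Real.tendsto_log_atTop.comp hUt) ?_
      · intro t ht
        have h0 := (hT t ht).1
        refine ((hU1 t).div (hU t) h0.ne').congr_deriv ?_
        rw [abs_of_pos h0, Real.rpow_sub_one h0.ne']
        field_simp
        ring
      · intro t ht
        have h0 := (hT t ht).1
        refine ((((hasDerivAt_id t).const_mul (-k)).exp).mul
          ((hU t).rpow_const (p := p - 1) (Or.inl h0.ne'))).congr_deriv ?_
        simp only [id]
        rw [Real.rpow_sub_one h0.ne' (p - 1), ← hθ]
        field_simp
        ring
      · have h1 := hz.rpow_const (p := p - 1) (Or.inr hp1.le)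
        rw [Real.zero_rpow hp1.ne'] at h1
        refine h1.congr' ?_
        filter_upwards [eventually_ge_atTop T] with t ht
        exact hwp1 t ht) t
  rw [← key, mul_right_comm, ← Real.exp_add]
  simp

/-- Uniqueness of the singular solution in the power case with `p > 2k + 1`:
every `C²` solution of `v'' + v'/r + V_k(r)|v|^p = 0` on `(0, e)` with
`v(r) → ∞` as `r → 0+` coincides with
`W(r) = (θ(1-θ))^{1/(p-1)} (1 - log r)^θ`, where `θ = k/(p-1)`. -/
theorem stmt17 (k p θ : ℝ) (hk : 0 < k) (hp : 2 * k + 1 < p)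
    (hθ : θ = k / (p - 1)) (v v' v'' : ℝ → ℝ)
    (hsol : IsSolPow k p v v' v'')
    (hsing : Tendsto v (𝓝[>] (0 : ℝ)) atTop) :
    ∀ r ∈ Set.Ioo (0 : ℝ) (Real.exp 1),
      v r = (θ * (1 - θ)) ^ (1 / (p - 1)) * (1 - Real.log r) ^ θ := by
  obtain ⟨h1, h2, -, h3⟩ := hsol
  have hp1 : 0 < p - 1 := by linarith
  have hθ' : θ * (p - 1) = k := by rw [hθ]; field_simp
  set R : ℝ → ℝ := fun t => Real.exp (1 - Real.exp t) with hR
  have hRm : ∀ t, R t ∈ Set.Ioo (0 : ℝ) (Real.exp 1) := fun t =>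
    ⟨Real.exp_pos _, Real.exp_lt_exp.2 (by linarith [Real.exp_pos t])⟩
  have hRd : ∀ t, HasDerivAt R (-(R t * Real.exp t)) t := fun t =>
    (((Real.hasDerivAt_exp t).const_sub 1).exp).congr_deriv (by simp only [hR]; ring)
  have hU : ∀ t, HasDerivAt (fun t => v (R t)) (v' (R t) * -(R t * Real.exp t)) t := fun t =>
    (h1 _ (hRm t)).comp t (hRd t)
  have hU1 : ∀ t, HasDerivAt (fun t => v' (R t) * -(R t * Real.exp t))
      (v' (R t) * -(R t * Real.exp t) - Real.exp (-k * t) * |v (R t)| ^ p) t := fun t => by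
    have hd := ((h2 _ (hRm t)).comp t (hRd t)).mul
      (((hRd t).mul (Real.hasDerivAt_exp t)).neg)
    refine hd.congr_deriv ?_
    have hRp := (hRm t).1
    have hV : Vk k (R t) = Real.exp (-k * t) / (R t ^ 2 * Real.exp t ^ 2) := by
      have e1 : 1 - Real.log (R t) = Real.exp t := by simp [hR]
      rw [Vk, e1, ← Real.exp_mul]
      have e2 : Real.exp (t * (2 + k)) = Real.exp t ^ 2 * Real.exp (k * t) := by
        rw [sq, ← Real.exp_add, ← Real.exp_add]; congr 1; ring
      rw [e2, neg_mul, Real.exp_neg]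
      field_simp
    have h4 := h3 _ (hRm t)
    rw [hV] at h4
    have h5 : v'' (R t) = - (v' (R t) / R t) -
        Real.exp (-k * t) / (R t ^ 2 * Real.exp t ^ 2) * |v (R t)| ^ p := by linarith
    simp only [Function.comp, Pi.mul_apply, Pi.neg_apply]
    rw [h5]
    have := Real.exp_pos t
    field_simp
    ring
  have hRt : Tendsto R atTop (𝓝[>] 0) := by
    rw [tendsto_nhdsWithin_iff]
    refine ⟨?_, Eventually.of_forall fun t => (hRm t).1⟩
    apply Real.tendsto_exp_atBot.comp
    exact tendsto_atBot_add_const_left _ _ (tendsto_neg_atTop_atBot.comp Real.tendsto_exp_atTop)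
  intro r hr
  have hs : 0 < 1 - Real.log r := by
    have := (Real.log_lt_iff_lt_exp hr.1).2 hr.2
    linarith
  have hfin := main_t hk hp hθ' hU hU1 (hsing.comp hRt) (Real.log (1 - Real.log r))
  have e : R (Real.log (1 - Real.log r)) = r := by
    simp only [hR]
    rw [Real.exp_log hs, sub_sub_cancel, Real.exp_log hr.1]
  simp only [e] at hfin
  rw [hfin, Real.rpow_def_of_pos hs θ, mul_comm (Real.log _) θ]
end

section
/- Let k > 0, p ≥ 2k + 1 with p satisfying 4θ^2 + 4(k-1)θ + 1 - 4k ≥ 0 where θ = k/(p-1) (equivalently, p ≥ p_JL^+ in the paper's notation), and let V_k(r) = 1/(r^2 (1 - log r)^{2+k}) for 0 < r < e. Let W(r) = (θ(1-θ))^{1/(p-1)} (1 - log r)^θ. For β > 0, let v(·, β) ∈ C^0([0, e)) ∩ C^2((0, e)) be the unique solution of v'' + v'/r + V_k(r) |v|^p = 0 on (0, e) with v(0, β) = β. Then: (i) v(r, β) < W(r) for all 0 < r < e; and (ii) if 0 < β < γ then v(r, β) < v(r, γ) for all 0 < r < e. -/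
open Filter Topology Set MeasureTheory

theorem core18 (z z' z'' : ℝ → ℝ)
    (h1 : ∀ s, 0 < s → HasDerivAt z (z' s) s)
    (h2 : ∀ s, 0 < s → HasDerivAt z' (z'' s) s)
    (hin : ∀ s, 0 < s → 0 < z s → 0 ≤ z'' s + z s / (4 * s ^ 2))
    (hlim : Tendsto (fun s => (s * z' s - z s / 2) / Real.sqrt s) atTop (𝓝 0))
    (hev : ∀ᶠ s in atTop, 0 < z s) : ∀ s, 0 < s → 0 < z s := by
  intro s1 hs1
  by_contra hneg
  push Not at hneg
  obtain ⟨S0, hS0⟩ := eventually_atTop.1 hev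
  set S := max S0 (s1 + 1) with hS
  have hS1 : s1 < S := lt_of_lt_of_le (by linarith) (le_max_right _ _)
  have hSpos : ∀ s, S ≤ s → 0 < z s := fun s hs => hS0 s (le_trans (le_max_left _ _) hs)
  have hcont : ContinuousOn z (Icc s1 S) := fun x hx =>
    (h1 x (lt_of_lt_of_le hs1 hx.1)).continuousAt.continuousWithinAt
  have hcomp : IsCompact (Icc s1 S ∩ z ⁻¹' Iic 0) :=
    isCompact_Icc.of_isClosed_subset
      (hcont.preimage_isClosed_of_isClosed isClosed_Icc isClosed_Iic) inter_subset_left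
  obtain ⟨s0, ⟨⟨hs0a, hs0b⟩, hs0z⟩, hmax⟩ := hcomp.exists_isGreatest ⟨s1, ⟨le_rfl, hS1.le⟩, hneg⟩
  have hs0 : 0 < s0 := lt_of_lt_of_le hs1 hs0a
  have hs0z' : z s0 ≤ 0 := hs0z
  have hpos : ∀ s, s0 < s → 0 < z s := by
    intro s hs
    by_contra hc
    push Not at hc
    rcases le_total S s with h | h
    · exact absurd (hSpos s h) (not_lt.2 hc)
    · exact absurd (hmax ⟨⟨by linarith, h⟩, hc⟩) (not_le.2 hs)
  have hs0S : s0 < S := by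
    rcases lt_or_eq_of_le hs0b with h | h
    · exact h
    · exact absurd (hSpos s0 h.ge) (not_lt.2 hs0z')
  have hF : ∀ s, 0 < s → HasDerivAt (fun s => (s * z' s - z s / 2) / Real.sqrt s)
      (s * (z'' s + z s / (4 * s ^ 2)) / Real.sqrt s) s := by
    intro s hs
    have hq : 0 < Real.sqrt s := Real.sqrt_pos.2 hs
    have hqq : Real.sqrt s ^ 2 = s := Real.sq_sqrt hs.le
    have := (((hasDerivAt_id s).mul (h2 s hs)).sub ((h1 s hs).div_const 2)).div
      (Real.hasDerivAt_sqrt hs.ne') hq.ne'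
    refine HasDerivAt.congr_deriv this (Eq.symm ?_)
    simp only [id, Pi.sub_apply, Pi.mul_apply]
    rw [hqq]
    generalize z s = a
    generalize z' s = b
    generalize z'' s = c
    set q := Real.sqrt s
    have : s = q ^ 2 := hqq.symm
    rw [this]
    field_simp
    ring
  have hG : ∀ s, 0 < s → HasDerivAt (fun s => z s / Real.sqrt s)
      ((s * z' s - z s / 2) / Real.sqrt s / s) s := by
    intro s hs
    have hq : 0 < Real.sqrt s := Real.sqrt_pos.2 hs
    have hqq : Real.sqrt s ^ 2 = s := Real.sq_sqrt hs.le
    have := (h1 s hs).div (Real.hasDerivAt_sqrt hs.ne') hq.ne'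
    refine HasDerivAt.congr_deriv this (Eq.symm ?_)
    rw [hqq]
    generalize z s = a
    generalize z' s = b
    set q := Real.sqrt s
    have : s = q ^ 2 := hqq.symm
    rw [this]
    field_simp
  have hmono : MonotoneOn (fun s => (s * z' s - z s / 2) / Real.sqrt s) (Ioi s0) := by
    apply monotoneOn_of_hasDerivWithinAt_nonneg (convex_Ioi s0)
      (f' := fun s => s * (z'' s + z s / (4 * s ^ 2)) / Real.sqrt s)
    · intro x hx
      exact (hF x (hs0.trans hx)).continuousAt.continuousWithinAt
    · intro x hx
      rw [interior_Ioi] at hx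
      exact (hF x (hs0.trans hx)).hasDerivWithinAt
    · intro x hx
      rw [interior_Ioi] at hx
      have hx0 : 0 < x := hs0.trans hx
      exact div_nonneg (mul_nonneg hx0.le (hin x hx0 (hpos x hx))) (Real.sqrt_nonneg _)
  have hle : ∀ s, s0 < s → (s * z' s - z s / 2) / Real.sqrt s ≤ 0 := by
    intro s hs
    refine ge_of_tendsto hlim ?_
    filter_upwards [eventually_ge_atTop s] with t ht
    exact hmono (mem_Ioi.2 hs) (mem_Ioi.2 (lt_of_lt_of_le hs ht)) ht
  have hanti : AntitoneOn (fun s => z s / Real.sqrt s) (Ici s0) := by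
    apply antitoneOn_of_hasDerivWithinAt_nonpos (convex_Ici s0)
      (f' := fun s => (s * z' s - z s / 2) / Real.sqrt s / s)
    · intro x hx
      exact (hG x (lt_of_lt_of_le hs0 hx)).continuousAt.continuousWithinAt
    · intro x hx
      rw [interior_Ici] at hx
      exact (hG x (hs0.trans hx)).hasDerivWithinAt
    · intro x hx
      rw [interior_Ici] at hx
      exact div_nonpos_of_nonpos_of_nonneg (hle x hx) (hs0.trans hx).le
  have h3 : z S / Real.sqrt S ≤ z s0 / Real.sqrt s0 :=
    hanti (mem_Ici.2 le_rfl) (mem_Ici.2 hs0S.le) hs0S.le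
  have h4 : 0 < z S / Real.sqrt S := div_pos (hSpos S le_rfl) (Real.sqrt_pos.2 (hs0.trans hs0S))
  have h5 : z s0 / Real.sqrt s0 ≤ 0 := div_nonpos_of_nonpos_of_nonneg hs0z' (Real.sqrt_nonneg _)
  linarith

theorem conv18 (p a b w : ℝ) (hp : 1 ≤ p) (hba : b < a) (haw : a ≤ w) (hw : 0 < w) :
    |a| ^ p - |b| ^ p ≤ p * w ^ (p - 1) * (a - b) := by
  rcases le_or_gt a 0 with ha | ha
  · have h1 : |a| ≤ |b| := by
      rw [abs_of_nonpos ha, abs_of_nonpos (hba.le.trans ha)]; linarith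
    have h2 : |a| ^ p ≤ |b| ^ p := Real.rpow_le_rpow (abs_nonneg _) h1 (by linarith)
    have h3 : 0 ≤ p * w ^ (p - 1) * (a - b) :=
      mul_nonneg (mul_nonneg (by linarith) (Real.rpow_nonneg hw.le _)) (by linarith)
    linarith
  · have h1 : 1 + p * (|b| / a - 1) ≤ (1 + (|b| / a - 1)) ^ p :=
      one_add_mul_self_le_rpow_one_add (by have := div_nonneg (abs_nonneg b) ha.le; linarith) hp
    have h2 : (1 + (|b| / a - 1)) ^ p = |b| ^ p / a ^ p := by
      rw [← Real.div_rpow (abs_nonneg _) ha.le]; congr 1; ring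
    rw [h2] at h1
    have hap : 0 < a ^ p := Real.rpow_pos_of_pos ha _
    have h3 : a ^ p = a ^ (p - 1) * a := by
      rw [← Real.rpow_add_one ha.ne']; congr 1; ring
    have h4 : a ^ p + p * a ^ (p - 1) * (|b| - a) ≤ |b| ^ p := by
      have := mul_le_mul_of_nonneg_right h1 hap.le
      rw [div_mul_cancel₀ _ hap.ne'] at this
      refine le_trans (le_of_eq ?_) this
      rw [h3]; field_simp
    have h5 : a ^ (p - 1) ≤ w ^ (p - 1) := Real.rpow_le_rpow ha.le haw (by linarith)
    have h6 : 0 ≤ p * a ^ (p - 1) := mul_nonneg (by linarith) (Real.rpow_nonneg ha.le _)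
    have h7 : p * a ^ (p - 1) * (a - |b|) ≤ p * a ^ (p - 1) * (a - b) :=
      mul_le_mul_of_nonneg_left (by linarith [le_abs_self b]) h6
    have h8 : p * a ^ (p - 1) * (a - b) ≤ p * w ^ (p - 1) * (a - b) :=
      mul_le_mul_of_nonneg_right (mul_le_mul_of_nonneg_left h5 (by linarith)) (by linarith)
    rw [abs_of_pos ha]
    linarith

/-- Solutions in the variable `s = 1 - log r`. -/
def Sol18 (k p : ℝ) (u u' : ℝ → ℝ) : Prop :=
  (∀ s, 0 < s → HasDerivAt u (u' s) s) ∧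
  (∀ s, 0 < s → HasDerivAt u' (-(s ^ (-(2 + k)) * |u s| ^ p)) s)

theorem lim18 (k p β : ℝ) (u u' : ℝ → ℝ) (h : Sol18 k p u u')
    (hl : Tendsto u atTop (𝓝 β)) :
    Tendsto (fun s => (s * u' s - u s / 2) / Real.sqrt s) atTop (𝓝 0) := by
  obtain ⟨h1, h2⟩ := h
  have hanti : AntitoneOn u' (Ioi 0) := by
    apply antitoneOn_of_hasDerivWithinAt_nonpos (convex_Ioi 0)
      (f' := fun s => -(s ^ (-(2 + k)) * |u s| ^ p))
    · intro x hx
      exact (h2 x hx).continuousAt.continuousWithinAt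
    · intro x hx
      rw [interior_Ioi] at hx
      exact (h2 x hx).hasDerivWithinAt
    · intro x hx
      rw [interior_Ioi] at hx
      have := mul_nonneg (Real.rpow_nonneg (le_of_lt hx) (-(2 + k)))
        (Real.rpow_nonneg (abs_nonneg (u x)) p)
      linarith
  have mvt : ∀ a b, 0 < a → a < b → ∃ c ∈ Ioo a b, u' c = (u b - u a) / (b - a) := by
    intro a b ha hab
    exact exists_hasDerivAt_eq_slope u u' hab
      (fun x hx => (h1 x (lt_of_lt_of_le ha hx.1)).continuousAt.continuousWithinAt)
      (fun x hx => h1 x (ha.trans hx.1))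
  have hsu : Tendsto (fun s => s * u' s) atTop (𝓝 0) := by
    have l1 : Tendsto (fun s => u (2 * s) - u s) atTop (𝓝 0) := by
      have := (hl.comp (tendsto_id.const_mul_atTop (show (0 : ℝ) < 2 by norm_num))).sub hl
      simpa using this
    have l2 : Tendsto (fun s => 2 * (u s - u (s / 2))) atTop (𝓝 0) := by
      have := (hl.sub (hl.comp (tendsto_id.atTop_div_const (show (0 : ℝ) < 2 by norm_num)))).const_mul 2
      simpa using this
    refine tendsto_of_tendsto_of_tendsto_of_le_of_le' l1 l2 ?_ ?_
    · filter_upwards [eventually_gt_atTop 0] with s hs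
      obtain ⟨c, hc, he⟩ := mvt s (2 * s) hs (by linarith)
      have h3 : u' c ≤ u' s := hanti (mem_Ioi.2 hs) (mem_Ioi.2 (hs.trans hc.1)) hc.1.le
      rw [he, div_le_iff₀ (by linarith)] at h3
      linarith
    · filter_upwards [eventually_gt_atTop 0] with s hs
      obtain ⟨c, hc, he⟩ := mvt (s / 2) s (by linarith) (by linarith)
      have h3 : u' s ≤ u' c := hanti (mem_Ioi.2 (by linarith [hc.1])) (mem_Ioi.2 hs) hc.2.le
      rw [he, le_div_iff₀ (by linarith)] at h3
      linarith
  exact (hsu.sub (hl.div_const 2)).div_atTop Real.tendsto_sqrt_atTop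

theorem comp18 (k p θ : ℝ) (w a a' b b' : ℝ → ℝ) (hp : 1 ≤ p)
    (hc : p * (θ * (1 - θ)) ≤ 1 / 4)
    (hw : ∀ s, 0 < s → 0 < w s) (hw' : ∀ s, 0 < s → w s ^ (p - 1) = θ * (1 - θ) * s ^ k)
    (ha : Sol18 k p a a') (hb : Sol18 k p b b') (haw : ∀ s, 0 < s → a s ≤ w s)
    (la : Tendsto (fun s => (s * a' s - a s / 2) / Real.sqrt s) atTop (𝓝 0))
    (lb : Tendsto (fun s => (s * b' s - b s / 2) / Real.sqrt s) atTop (𝓝 0))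
    (hev : ∀ᶠ s in atTop, b s < a s) : ∀ s, 0 < s → b s < a s := by
  intro s hs
  have := core18 (fun s => a s - b s) (fun s => a' s - b' s)
    (fun s => -(s ^ (-(2 + k)) * |a s| ^ p) - -(s ^ (-(2 + k)) * |b s| ^ p))
    (fun s hs => (ha.1 s hs).sub (hb.1 s hs)) (fun s hs => (ha.2 s hs).sub (hb.2 s hs))
    ?_ ?_ ?_ s hs
  · linarith
  · intro s hs hz
    have h1 := conv18 p (a s) (b s) (w s) hp (by linarith) (haw s hs) (hw s hs)
    rw [hw' s hs] at h1
    have h2 : s ^ (-(2 + k)) * s ^ k = 1 / s ^ 2 := by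
      rw [← Real.rpow_add hs, show -(2 + k) + k = -2 by ring, Real.rpow_neg hs.le]
      norm_num
    have h3 := mul_le_mul_of_nonneg_left h1 (Real.rpow_nonneg hs.le (-(2 + k)))
    have h4 : s ^ (-(2 + k)) * (p * (θ * (1 - θ) * s ^ k) * (a s - b s))
        = (p * (θ * (1 - θ))) * ((a s - b s) / s ^ 2) := by
      calc _ = (s ^ (-(2 + k)) * s ^ k) * (p * (θ * (1 - θ)) * (a s - b s)) := by ring
        _ = _ := by rw [h2]; ring
    have h5 : (p * (θ * (1 - θ))) * ((a s - b s) / s ^ 2) ≤ 1 / 4 * ((a s - b s) / s ^ 2) :=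
      mul_le_mul_of_nonneg_right hc (by positivity)
    have h6 : (a s - b s) / (4 * s ^ 2) = 1 / 4 * ((a s - b s) / s ^ 2) := by
      field_simp
    rw [h6]
    linarith
  · have := la.sub lb
    rw [sub_zero] at this
    refine this.congr (fun s => ?_)
    ring
  · filter_upwards [hev] with s hs
    linarith

theorem trans18 (k p β : ℝ) (v v' v'' : ℝ → ℝ)
    (hc : ContinuousOn v (Set.Ico 0 (Real.exp 1))) (h0 : v 0 = β)
    (hs : IsSolPow k p v v' v'') :
    Sol18 k p (fun s => v (Real.exp (1 - s))) (fun s => -(Real.exp (1 - s) * v' (Real.exp (1 - s))))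
    ∧ Tendsto (fun s => v (Real.exp (1 - s))) atTop (𝓝 β) := by
  obtain ⟨h1, h2, -, h4⟩ := hs
  have hmem : ∀ s : ℝ, 0 < s → Real.exp (1 - s) ∈ Set.Ioo (0 : ℝ) (Real.exp 1) := fun s hs =>
    ⟨Real.exp_pos _, Real.exp_lt_exp.2 (by linarith)⟩
  have he : ∀ s : ℝ, HasDerivAt (fun s => Real.exp (1 - s)) (-Real.exp (1 - s)) s := by
    intro s
    have := ((hasDerivAt_id s).const_sub 1).exp
    simpa using this
  refine ⟨⟨fun s hs => ?_, fun s hs => ?_⟩, ?_⟩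
  · have := (h1 _ (hmem s hs)).comp s (he s)
    refine HasDerivAt.congr_deriv this (Eq.symm ?_)
    ring
  · have := ((he s).mul ((h2 _ (hmem s hs)).comp s (he s))).neg
    refine HasDerivAt.congr_deriv this (Eq.symm ?_)
    have e := h4 _ (hmem s hs)
    unfold Vk at e
    rw [Real.log_exp, show 1 - (1 - s) = s by ring] at e
    simp only [Function.comp]
    have hr : 0 < Real.exp (1 - s) := Real.exp_pos _
    rw [Real.rpow_neg hs.le]
    have hq : 0 < s ^ (2 + k) := Real.rpow_pos_of_pos hs _
    set r := Real.exp (1 - s)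
    generalize s ^ (2 + k) = q at *
    generalize |v r| ^ p = y at *
    have e2 : v'' r = -(v' r / r) - 1 / (r ^ 2 * q) * y := by linarith
    rw [e2]
    field_simp
    ring
  · have hc0 : Tendsto v (𝓝[Set.Ico 0 (Real.exp 1)] 0) (𝓝 (v 0)) :=
      hc 0 ⟨le_rfl, Real.exp_pos _⟩
    rw [← h0]
    refine hc0.comp (tendsto_nhdsWithin_iff.2 ⟨?_, ?_⟩)
    · exact Real.tendsto_exp_atBot.comp (tendsto_atBot_add_const_left atTop 1 tendsto_neg_atTop_atBot)
    · filter_upwards [eventually_gt_atTop 0] with s hs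
      exact ⟨(hmem s hs).1.le, (hmem s hs).2⟩

/-- Separation property in the power case for `p ≥ p⁺_JL` (i.e. `p ≥ 2k + 1`
and `4θ² + 4(k-1)θ + 1 - 4k ≥ 0` with `θ = k/(p-1)`): regular solutions lie
strictly below the singular solution `W(r) = (θ(1-θ))^{1/(p-1)} (1-log r)^θ`,
and are strictly ordered in `β`. -/
theorem stmt18 (k p θ : ℝ) (hk : 0 < k) (hθ : θ = k / (p - 1))
    (hp : 2 * k + 1 ≤ p)
    (hJL : 0 ≤ 4 * θ ^ 2 + 4 * (k - 1) * θ + 1 - 4 * k)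
    (β γ : ℝ) (hβ : 0 < β) (hβγ : β < γ)
    (vβ vβ' vβ'' vγ vγ' vγ'' : ℝ → ℝ)
    (hcβ : ContinuousOn vβ (Set.Ico 0 (Real.exp 1))) (h0β : vβ 0 = β)
    (hsβ : IsSolPow k p vβ vβ' vβ'')
    (hcγ : ContinuousOn vγ (Set.Ico 0 (Real.exp 1))) (h0γ : vγ 0 = γ)
    (hsγ : IsSolPow k p vγ vγ' vγ'') :
    (∀ r ∈ Set.Ioo (0 : ℝ) (Real.exp 1),
      vβ r < (θ * (1 - θ)) ^ (1 / (p - 1)) * (1 - Real.log r) ^ θ) ∧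
    (∀ r ∈ Set.Ioo (0 : ℝ) (Real.exp 1), vβ r < vγ r) := by
  have hp1 : 0 < p - 1 := by linarith
  have hkθ : θ * (p - 1) = k := by rw [hθ]; field_simp
  have hθ0 : 0 < θ := by rw [hθ]; positivity
  have hθ2 : θ < 1 / 2 := by
    have h1 : θ ≤ 1 / 2 := by
      rw [hθ, div_le_iff₀ hp1]; linarith
    rcases lt_or_eq_of_le h1 with h | h
    · exact h
    · rw [h] at hJL; nlinarith
  have hA : 0 < θ * (1 - θ) := mul_pos hθ0 (by linarith)
  set A := (θ * (1 - θ)) ^ (1 / (p - 1)) with hAdef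
  have hA0 : 0 < A := Real.rpow_pos_of_pos hA _
  have hAp : A ^ (p - 1) = θ * (1 - θ) := by
    rw [hAdef, ← Real.rpow_mul hA.le, one_div_mul_cancel hp1.ne', Real.rpow_one]
  have hc : p * (θ * (1 - θ)) ≤ 1 / 4 := by
    have : p * θ = k + θ := by linarith
    have h2 : p * (θ * (1 - θ)) = (k + θ) * (1 - θ) := by rw [← this]; ring
    rw [h2]; nlinarith
  have hw : ∀ s : ℝ, 0 < s → 0 < A * s ^ θ := fun s hs => mul_pos hA0 (Real.rpow_pos_of_pos hs _)
  have hw' : ∀ s : ℝ, 0 < s → (A * s ^ θ) ^ (p - 1) = θ * (1 - θ) * s ^ k := by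
    intro s hs
    rw [Real.mul_rpow hA0.le (Real.rpow_nonneg hs.le _), hAp, ← Real.rpow_mul hs.le, hkθ]
  have hW : Sol18 k p (fun s => A * s ^ θ) (fun s => A * (θ * s ^ (θ - 1))) := by
    refine ⟨fun s hs => (Real.hasDerivAt_rpow_const (Or.inl hs.ne')).const_mul A, fun s hs => ?_⟩
    have := ((Real.hasDerivAt_rpow_const (p := θ - 1) (Or.inl hs.ne')).const_mul θ).const_mul A
    refine HasDerivAt.congr_deriv this (Eq.symm ?_)
    rw [abs_of_pos (hw s hs)]
    have h3 : (A * s ^ θ) ^ p = (θ * (1 - θ) * s ^ k) * (A * s ^ θ) := by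
      rw [← hw' s hs, ← Real.rpow_add_one (hw s hs).ne']; congr 1; ring
    have h4 : s ^ (θ - 1 - 1) = s ^ (-(2 + k)) * s ^ k * s ^ θ := by
      rw [← Real.rpow_add hs, ← Real.rpow_add hs]; congr 1; ring
    rw [h3, h4]; ring
  have lW : Tendsto (fun s : ℝ => (s * (A * (θ * s ^ (θ - 1))) - A * s ^ θ / 2) / Real.sqrt s)
      atTop (𝓝 0) := by
    have h1 := (tendsto_rpow_neg_atTop (show 0 < 1 / 2 - θ by linarith)).const_mul (A * (θ - 1 / 2))
    rw [mul_zero] at h1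
    refine h1.congr' ?_
    filter_upwards [eventually_gt_atTop 0] with s hs
    have h2 : s ^ θ = s ^ (θ - 1) * s := by
      rw [← Real.rpow_add_one hs.ne']; congr 1; ring
    have h3 : s ^ (-(1 / 2 - θ)) = s ^ θ / Real.sqrt s := by
      rw [Real.sqrt_eq_rpow, ← Real.rpow_sub hs]; congr 1; ring
    rw [h3, h2]; ring
  have key : ∀ (β : ℝ) (v v' v'' : ℝ → ℝ), ContinuousOn v (Set.Ico 0 (Real.exp 1)) → v 0 = β →
      IsSolPow k p v v' v'' → ∀ s, 0 < s → v (Real.exp (1 - s)) < A * s ^ θ := by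
    intro β v v' v'' hcv h0 hs
    obtain ⟨hS, hL⟩ := trans18 k p β v v' v'' hcv h0 hs
    refine comp18 k p θ (fun s => A * s ^ θ) _ _ _ _ (by linarith) hc hw hw' hW hS
      (fun s _ => le_rfl) lW (lim18 k p β _ _ hS hL) ?_
    have h1 : Tendsto (fun s : ℝ => A * s ^ θ) atTop atTop :=
      (tendsto_rpow_atTop hθ0).const_mul_atTop hA0
    filter_upwards [h1.eventually_ge_atTop (β + 1), hL.eventually_lt_const (lt_add_one β)] with s a b
    exact lt_of_lt_of_le b a
  have hr : ∀ r ∈ Set.Ioo (0 : ℝ) (Real.exp 1), 0 < 1 - Real.log r ∧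
      Real.exp (1 - (1 - Real.log r)) = r := by
    intro r hr
    refine ⟨?_, ?_⟩
    · have := Real.log_lt_log hr.1 hr.2
      rw [Real.log_exp] at this; linarith
    · rw [sub_sub_cancel, Real.exp_log hr.1]
  refine ⟨fun r hrr => ?_, fun r hrr => ?_⟩
  · have := key β vβ vβ' vβ'' hcβ h0β hsβ _ (hr r hrr).1
    rwa [(hr r hrr).2] at this
  · obtain ⟨hS, hL⟩ := trans18 k p β vβ vβ' vβ'' hcβ h0β hsβ
    obtain ⟨hS2, hL2⟩ := trans18 k p γ vγ vγ' vγ'' hcγ h0γ hsγ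
    have := comp18 k p θ (fun s => A * s ^ θ) _ _ _ _ (by linarith) hc hw hw' hS2 hS
      (fun s hs => (key γ vγ vγ' vγ'' hcγ h0γ hsγ s hs).le) (lim18 k p γ _ _ hS2 hL2)
      (lim18 k p β _ _ hS hL) (hL.eventually_lt hL2 hβγ) _ (hr r hrr).1
    simp only [(hr r hrr).2] at this
    exact this
end

section
/- Let q ∈ ℝ, l ∈ ℝ, and let a, b : ℝ → ℝ be continuous functions with a(t) > b(t) for all t < l. Suppose y, z : ℝ → ℝ are C^2 functions satisfying y''(t) + q y'(t) + a(t) y(t) = 0 and z''(t) + q z'(t) + b(t) z(t) = 0 for all t ∈ ℝ. Assume z changes sign infinitely many times on (-∞, l), i.e. for every T < l there exist t_1 < t_2 < T with z(t_1) < 0 < z(t_2). Then every solution y that is not identically zero also changes sign infinitely many times on (-∞, l). -/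
open Filter Topology Set

lemma aux_unique_s19 (q : ℝ) (a : ℝ → ℝ) (ha : Continuous a) (y y' y'' : ℝ → ℝ)
    (h1 : ∀ t : ℝ, HasDerivAt y (y' t) t)
    (h2 : ∀ t : ℝ, HasDerivAt y' (y'' t) t)
    (heq : ∀ t : ℝ, y'' t + q * y' t + a t * y t = 0)
    (m : ℝ) (hm : y m = 0) (hm' : y' m = 0) (t : ℝ) : y t = 0 := by
  obtain ⟨M, hM⟩ := (isCompact_uIcc (a := m) (b := t)).exists_bound_of_continuousOn
    ha.continuousOn
  set C : ℝ := 1 + M + 2 * |q| with hC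
  have hE : ∀ (k s : ℝ), HasDerivAt (fun s => Real.exp (k * s) * (y s ^ 2 + y' s ^ 2))
      (Real.exp (k * s) * (k * (y s ^ 2 + y' s ^ 2) + (2 * y s * y' s + 2 * y' s * y'' s))) s := by
    intro k s
    have e1 : HasDerivAt (fun s => Real.exp (k * s)) (Real.exp (k * s) * k) s := by
      simpa using ((hasDerivAt_id s).const_mul k).exp
    have := e1.mul (((h1 s).pow 2).add ((h2 s).pow 2))
    refine this.congr_deriv ?_
    simp
    ring
  have hb : ∀ s ∈ uIcc m t, |2 * y s * y' s + 2 * y' s * y'' s| ≤ C * (y s ^ 2 + y' s ^ 2) := by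
    intro s hs
    have hMs := hM s hs
    rw [Real.norm_eq_abs] at hMs
    have e : y'' s = - q * y' s - a s * y s := by linarith [heq s]
    have e2 : 2 * y s * y' s + 2 * y' s * y'' s
        = (1 - a s) * (2 * y s * y' s) + (- 2 * q) * y' s ^ 2 := by rw [e]; ring
    have b1 : |2 * y s * y' s| ≤ y s ^ 2 + y' s ^ 2 := by
      rw [abs_le]; constructor <;> nlinarith [sq_nonneg (y s + y' s), sq_nonneg (y s - y' s)]
    have b2 : |1 - a s| ≤ 1 + M := by
      rw [abs_le] at hMs ⊢; constructor <;> linarith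
    have b3 : |(1 - a s) * (2 * y s * y' s)| ≤ (1 + M) * (y s ^ 2 + y' s ^ 2) := by
      rw [abs_mul]
      exact mul_le_mul b2 b1 (abs_nonneg _) ((abs_nonneg _).trans b2)
    have b4 : |(- 2 * q) * y' s ^ 2| ≤ 2 * |q| * (y s ^ 2 + y' s ^ 2) := by
      rw [abs_mul, abs_mul, abs_of_nonneg (sq_nonneg (y' s))]
      norm_num
      nlinarith [mul_nonneg (abs_nonneg q) (sq_nonneg (y s))]
    rw [e2, hC]
    refine (abs_add_le _ _).trans ?_
    linarith
  have hfin : y t ^ 2 + y' t ^ 2 ≤ 0 := by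
    rcases le_total m t with hmt | hmt
    · rw [uIcc_of_le hmt] at hb
      have anti : AntitoneOn (fun s => Real.exp (-C * s) * (y s ^ 2 + y' s ^ 2)) (Icc m t) := by
        refine antitoneOn_of_hasDerivWithinAt_nonpos (convex_Icc m t)
          (fun s _ => (hE (-C) s).continuousAt.continuousWithinAt)
          (fun s _ => (hE (-C) s).hasDerivWithinAt) ?_
        intro s hs
        have := (abs_le.1 (hb s (interior_subset hs))).2
        exact mul_nonpos_of_nonneg_of_nonpos (Real.exp_pos _).le (by linarith)
      have := anti (left_mem_Icc.2 hmt) (right_mem_Icc.2 hmt) hmt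
      simp only [hm, hm'] at this
      by_contra hcon
      push Not at hcon
      have := mul_pos (Real.exp_pos (-C * t)) hcon
      norm_num at *
      linarith
    · rw [uIcc_of_ge hmt] at hb
      have mono : MonotoneOn (fun s => Real.exp (C * s) * (y s ^ 2 + y' s ^ 2)) (Icc t m) := by
        refine monotoneOn_of_hasDerivWithinAt_nonneg (convex_Icc t m)
          (fun s _ => (hE C s).continuousAt.continuousWithinAt)
          (fun s _ => (hE C s).hasDerivWithinAt) ?_
        intro s hs
        have := (abs_le.1 (hb s (interior_subset hs))).1
        exact mul_nonneg (Real.exp_pos _).le (by linarith)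
      have := mono (left_mem_Icc.2 hmt) (right_mem_Icc.2 hmt) hmt
      simp only [hm, hm'] at this
      by_contra hcon
      push Not at hcon
      have := mul_pos (Real.exp_pos (C * t)) hcon
      norm_num at *
      linarith
  nlinarith [sq_nonneg (y t), sq_nonneg (y' t)]

lemma aux_left (z : ℝ → ℝ) (hz : Continuous z) (s t : ℝ) (hst : s < t) (h1 : 0 < z s)
    (h2 : z t < 0) : ∃ α, s ≤ α ∧ α < t ∧ z α = 0 ∧ ∀ x, α < x → x ≤ t → z x < 0 := by
  have hcomp : IsCompact (Icc s t ∩ {x | 0 ≤ z x}) :=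
    isCompact_Icc.inter_right (isClosed_le continuous_const hz)
  obtain ⟨α, ⟨⟨hα1, hα2⟩, hα3⟩, hmax⟩ := hcomp.exists_isGreatest
    ⟨s, ⟨le_rfl, hst.le⟩, h1.le⟩
  have hα3 : 0 ≤ z α := hα3
  have hlt : α < t := lt_of_le_of_ne hα2 (by rintro rfl; linarith)
  have hneg : ∀ x, α < x → x ≤ t → z x < 0 := by
    intro x hx hxt
    by_contra hc
    have := hmax ⟨⟨hα1.trans hx.le, hxt⟩, not_lt.1 hc⟩
    linarith
  refine ⟨α, hα1, hlt, ?_, hneg⟩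
  obtain ⟨w, hw, hw0⟩ := intermediate_value_Icc' hlt.le hz.continuousOn ⟨h2.le, hα3⟩
  rcases hw.1.eq_or_lt with h | h
  · rw [h]; exact hw0
  · exact absurd hw0 (hneg w h hw.2).ne

lemma aux_main (q l : ℝ) (a b : ℝ → ℝ)
    (ha : Continuous a)
    (hab : ∀ t : ℝ, t < l → b t < a t)
    (y y' y'' z z' z'' : ℝ → ℝ)
    (hyd1 : ∀ t : ℝ, HasDerivAt y (y' t) t)
    (hyd2 : ∀ t : ℝ, HasDerivAt y' (y'' t) t)
    (hzd1 : ∀ t : ℝ, HasDerivAt z (z' t) t)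
    (hzd2 : ∀ t : ℝ, HasDerivAt z' (z'' t) t)
    (hyeq : ∀ t : ℝ, y'' t + q * y' t + a t * y t = 0)
    (hzeq : ∀ t : ℝ, z'' t + q * z' t + b t * z t = 0)
    (hzosc : ∀ T : ℝ, T < l → ∃ t₁ t₂ : ℝ, t₁ < t₂ ∧ t₂ < T ∧ z t₁ < 0 ∧ 0 < z t₂)
    (hy : y ≠ fun _ => 0) (T : ℝ) (hT : T < l) : ∃ t, t < T ∧ y t < 0 := by
  by_contra! hpos
  have hzcont : Continuous z := continuous_iff_continuousAt.2 fun t => (hzd1 t).continuousAt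
  obtain ⟨t1, t2, h12, h2T, hz1, hz2⟩ := hzosc T hT
  obtain ⟨_, s, _, hs1, _, hzs⟩ := hzosc t1 (by linarith)
  obtain ⟨α, _, hα1, hzα, hαneg⟩ := aux_left z hzcont s t1 hs1 hzs hz1
  obtain ⟨β', hβ2, hβ1, hzβ, hβneg⟩ := aux_left (fun x => z (-x)) (hzcont.comp continuous_neg)
    (-t2) (-t1) (by linarith) (by simpa using hz2) (by simpa using hz1)
  obtain ⟨β, rfl⟩ : ∃ β, β' = -β := ⟨-β', by ring⟩
  simp only [neg_neg] at hzβ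
  have hneg : ∀ x, α < x → x < β → z x < 0 := by
    intro x h1 h2
    rcases le_total x t1 with h | h
    · exact hαneg x h1 h
    · simpa using hβneg (-x) (by linarith) (by linarith)
  have hαβ : α < β := by linarith
  have hz'α : z' α ≤ 0 := by
    have h := (hasDerivWithinAt_iff_tendsto_slope' (s := Ioi α) (by simp)).1
      (hzd1 α).hasDerivWithinAt
    refine le_of_tendsto h ?_
    filter_upwards [Ioo_mem_nhdsGT hαβ] with x hx
    rw [slope_def_field, hzα]
    exact div_nonpos_of_nonpos_of_nonneg (by linarith [hneg x hx.1 hx.2]) (by linarith [hx.1])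
  have hz'β : 0 ≤ z' β := by
    have h := (hasDerivWithinAt_iff_tendsto_slope' (s := Iio β) (by simp)).1
      (hzd1 β).hasDerivWithinAt
    refine ge_of_tendsto h ?_
    filter_upwards [Ioo_mem_nhdsLT hαβ] with x hx
    rw [slope_def_field, hzβ]
    exact div_nonneg_of_nonpos (by linarith [hneg x hx.1 hx.2]) (by linarith [hx.2])
  set W : ℝ → ℝ := fun t => Real.exp (q * t) * (z' t * y t - y' t * z t) with hW
  have hWd : ∀ t, HasDerivAt W (Real.exp (q * t) * (y t * z t * (a t - b t))) t := by
    intro t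
    have e1 : HasDerivAt (fun s => Real.exp (q * s)) (Real.exp (q * t) * q) t := by
      simpa using ((hasDerivAt_id t).const_mul q).exp
    have := e1.mul (((hzd2 t).mul (hyd1 t)).sub ((hyd2 t).mul (hzd1 t)))
    refine this.congr_deriv ?_
    have e2 : y'' t = - q * y' t - a t * y t := by linarith [hyeq t]
    have e3 : z'' t = - q * z' t - b t * z t := by linarith [hzeq t]
    simp only [e2, e3, Pi.mul_apply, Pi.sub_apply]
    ring
  have anti : AntitoneOn W (Icc α β) := by
    refine antitoneOn_of_hasDerivWithinAt_nonpos (convex_Icc α β)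
      (fun s _ => (hWd s).continuousAt.continuousWithinAt)
      (fun s _ => (hWd s).hasDerivWithinAt) ?_
    intro s hs
    rw [interior_Icc] at hs
    have h1 := hpos s (by linarith [hs.2])
    have h2 := hneg s hs.1 hs.2
    have h3 := hab s (by linarith [hs.2])
    refine mul_nonpos_of_nonneg_of_nonpos (Real.exp_pos _).le ?_
    exact mul_nonpos_of_nonpos_of_nonneg (mul_nonpos_of_nonneg_of_nonpos h1 h2.le) (by linarith)
  have hWα : W α ≤ 0 := by
    simp only [hW, hzα, mul_zero, sub_zero]
    exact mul_nonpos_of_nonneg_of_nonpos (Real.exp_pos _).le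
      (mul_nonpos_of_nonpos_of_nonneg hz'α (hpos α (by linarith)))
  have hWβ : 0 ≤ W β := by
    simp only [hW, hzβ, mul_zero, sub_zero]
    exact mul_nonneg (Real.exp_pos _).le (mul_nonneg hz'β (hpos β (by linarith)))
  have hW0 : ∀ x ∈ Ioo α β, W x = 0 := by
    intro x hx
    have h1 := anti (left_mem_Icc.2 hαβ.le) (Ioo_subset_Icc_self hx) hx.1.le
    have h2 := anti (Ioo_subset_Icc_self hx) (right_mem_Icc.2 hαβ.le) hx.2.le
    linarith
  have hy0 : ∀ x ∈ Ioo α β, y x = 0 := by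
    intro x hx
    have hev : W =ᶠ[𝓝 x] fun _ => 0 := by
      filter_upwards [Ioo_mem_nhds hx.1 hx.2] with u hu using hW0 u hu
    have h := (hWd x).unique ((hasDerivAt_const x (0:ℝ)).congr_of_eventuallyEq hev)
    have h2 := hneg x hx.1 hx.2
    have h3 := hab x (by linarith [hx.2])
    have h4 : a x - b x ≠ 0 := by linarith
    simpa [(Real.exp_pos (q * x)).ne', h2.ne, h4] using h
  have hm : (α + β) / 2 ∈ Ioo α β := ⟨by linarith, by linarith⟩
  have hev : y =ᶠ[𝓝 ((α + β) / 2)] fun _ => 0 := by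
    filter_upwards [Ioo_mem_nhds hm.1 hm.2] with u hu using hy0 u hu
  have hm' := (hyd1 _).unique ((hasDerivAt_const _ (0:ℝ)).congr_of_eventuallyEq hev)
  exact hy (funext fun t => aux_unique_s19 q a ha y y' y'' hyd1 hyd2 hyeq _ (hy0 _ hm) hm' t)

/-- Sturm-type comparison theorem with a damping term: if `a > b` on
`(-∞, l)`, `y'' + q y' + a y = 0`, `z'' + q z' + b z = 0`, and `z` changes
sign infinitely many times on `(-∞, l)`, then every nontrivial solution `y`
also changes sign infinitely many times on `(-∞, l)`. -/
theorem stmt19 (q l : ℝ) (a b : ℝ → ℝ)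
    (ha : Continuous a) (hb : Continuous b)
    (hab : ∀ t : ℝ, t < l → b t < a t)
    (y y' y'' z z' z'' : ℝ → ℝ)
    (hyd1 : ∀ t : ℝ, HasDerivAt y (y' t) t)
    (hyd2 : ∀ t : ℝ, HasDerivAt y' (y'' t) t)
    (hyc : Continuous y'')
    (hzd1 : ∀ t : ℝ, HasDerivAt z (z' t) t)
    (hzd2 : ∀ t : ℝ, HasDerivAt z' (z'' t) t)
    (hzc : Continuous z'')
    (hyeq : ∀ t : ℝ, y'' t + q * y' t + a t * y t = 0)
    (hzeq : ∀ t : ℝ, z'' t + q * z' t + b t * z t = 0)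
    (hzosc : ∀ T : ℝ, T < l → ∃ t₁ t₂ : ℝ, t₁ < t₂ ∧ t₂ < T ∧ z t₁ < 0 ∧ 0 < z t₂)
    (hy : y ≠ fun _ => 0) :
    ∀ T : ℝ, T < l → ∃ t₁ t₂ : ℝ, t₁ < t₂ ∧ t₂ < T ∧ y t₁ < 0 ∧ 0 < y t₂ := by
  intro T hT
  obtain ⟨t2, h2, hy2⟩ := aux_main q l a b ha hab (fun t => - y t) (fun t => - y' t)
    (fun t => - y'' t) z z' z'' (fun t => (hyd1 t).neg) (fun t => (hyd2 t).neg) hzd1 hzd2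
    (fun t => by linarith [hyeq t]) hzeq hzosc
    (fun h => hy (funext fun t => by simpa using congrFun h t)) T hT
  obtain ⟨t1, h1, hy1⟩ := aux_main q l a b ha hab y y' y'' z z' z'' hyd1 hyd2 hzd1 hzd2
    hyeq hzeq hzosc hy t2 (h2.trans hT)
  exact ⟨t1, t2, h1, h2, hy1, by linarith⟩
end
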